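/- arXiv:1806.00315 — 3 statements merged into one kernel-verified Lean document; each statement's English description precedes it below -/
import Mathlib

section
/- Let L be a first-order language equipped with an L-structure on ℤ such that the order relation {(a,b) ∈ ℤ² : a < b}, the graph of addition {(a,b,c) ∈ ℤ³ : a + b = c}, and the singleton {1} are definable without parameters. Suppose the theory Th(ℤ,L) satisfies the exchange property. Then no subset of ℤ that is L-definable with parameters is expanding; that is, for every L-definable (with parameters) set X ⊆ ℤ there exists n ≥ 1 such that the set {x ∈ X : for all i with 1 ≤ i ≤ n, x + i ∉ X} is finite. -/
open FirstOrder

/-- The definable closure of `A` in an `L`-structure `M`: the set of `a` such that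
`{a}` is `L`-definable with parameters from `A`. -/
def dcl (L : FirstOrder.Language) (M : Type*) [L.Structure M] (A : Set M) : Set M :=
  {a : M | A.Definable₁ L ({a} : Set M)}

/-- `Th(ℤ, L)` satisfies the exchange property: in every `L`-structure elementarily
equivalent to `ℤ`, definable closure satisfies exchange. -/
def HasEP (L : FirstOrder.Language) [L.Structure ℤ] : Prop :=
  ∀ (M : Type) [L.Structure M], (ℤ ≅[L] M) →
    ∀ (A : Set M) (a b : M),
      a ∈ dcl L M (A ∪ {b}) → a ∉ dcl L M A → b ∈ dcl L M (A ∪ {a})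

/-- Index set of the ultrapower. -/
abbrev IdxEP : Type := Finset (ℤ → ℤ)

/-- An ultrafilter on the index set containing all cones. -/
noncomputable def ultraEP : Ultrafilter IdxEP := Ultrafilter.of Filter.atTop

/-- The ultrapower of the integers. -/
abbrev PowEP : Type := (ultraEP : Filter IdxEP).Product (fun _ => ℤ)

/-- The class of a sequence. -/
noncomputable def clsEP (x : IdxEP → ℤ) : PowEP := Quotient.mk _ x

theorem clsEP_surj (p : PowEP) : ∃ x, clsEP x = p := Quotient.exists_rep p

theorem clsEP_eq (x y : IdxEP → ℤ) :
    clsEP x = clsEP y ↔ ∀ᶠ s in (ultraEP : Filter IdxEP), x s = y s := by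
  unfold clsEP
  exact Quotient.eq''

theorem ultraEP_mem (f : ℤ → ℤ) : ∀ᶠ s in (ultraEP : Filter IdxEP), f ∈ s := by
  have h : (ultraEP : Filter IdxEP) ≤ Filter.atTop := Ultrafilter.of_le _
  apply h
  filter_upwards [Filter.eventually_ge_atTop ({f} : Finset (ℤ → ℤ))] with s hs
  exact hs (Finset.mem_singleton_self f)

theorem losEP (L : FirstOrder.Language) [L.Structure ℤ] {β : Type*} (φ : L.Formula β)
    (x : β → IdxEP → ℤ) :
    (φ.Realize fun i => clsEP (x i)) ↔
      ∀ᶠ s in (ultraEP : Filter IdxEP), φ.Realize fun i => x i s :=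
  FirstOrder.Language.Ultraproduct.realize_formula_cast (M := fun _ : IdxEP => ℤ) φ x

theorem equivEP (L : FirstOrder.Language) [L.Structure ℤ] : ℤ ≅[L] PowEP := by
  rw [FirstOrder.Language.elementarilyEquivalent_iff]
  intro φ
  have := FirstOrder.Language.Ultraproduct.sentence_realize
    (M := fun _ : IdxEP => ℤ) (u := ultraEP) φ
  rw [this]
  simp

/-- If every parameter is the value at `t` of a function, then so is anything in the
definable closure. -/
theorem dclEP (L : FirstOrder.Language) [L.Structure ℤ] (B : Set PowEP) {T : Type}
    (t : IdxEP → T) (hB : ∀ p ∈ B, ∃ q : T → ℤ, p = clsEP (fun s => q (t s)))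
    (z : IdxEP → ℤ) (hz : clsEP z ∈ dcl L PowEP B) :
    ∃ g : T → ℤ, ∀ᶠ s in (ultraEP : Filter IdxEP), z s = g (t s) := by
  classical
  obtain ⟨φ, hφ⟩ := Set.definable_iff_exists_formula_sum.1 hz
  choose q hq using fun p : B => hB p.1 p.2
  have key : ∀ y : IdxEP → ℤ, clsEP y = clsEP z ↔
      ∀ᶠ s in (ultraEP : Filter IdxEP),
        φ.Realize (Sum.elim (fun p : B => q p (t s)) (fun _ : Fin 1 => y s)) := by
    intro y
    have h1 := Set.ext_iff.1 hφ (fun _ => clsEP y)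
    have h2 := losEP L φ (Sum.elim (fun p : B => fun s => q p (t s)) (fun _ : Fin 1 => y))
    have h3 : (fun i => clsEP ((Sum.elim (fun p : B => fun s => q p (t s))
        (fun _ : Fin 1 => y)) i)) = Sum.elim ((↑) : B → PowEP) (fun _ : Fin 1 => clsEP y) := by
      funext i
      rcases i with p | i
      · exact (hq p).symm
      · rfl
    rw [h3] at h2
    have h4 : ∀ s, (fun i => (Sum.elim (fun p : B => fun s => q p (t s))
        (fun _ : Fin 1 => y)) i s) =
        Sum.elim (fun p : B => q p (t s)) (fun _ : Fin 1 => y s) := by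
      intro s
      funext i
      rcases i with p | i <;> rfl
    simp only [h4] at h2
    rw [← h2]
    exact h1
  let P : T → ℤ → Prop := fun a y =>
    φ.Realize (Sum.elim (fun p : B => q p a) (fun _ : Fin 1 => y))
  have hzP : ∀ᶠ s in (ultraEP : Filter IdxEP), P (t s) (z s) := (key z).1 rfl
  let g : T → ℤ := fun a => if h : ∃ y, P a y then h.choose else 0
  refine ⟨g, ?_⟩
  have hg : ∀ᶠ s in (ultraEP : Filter IdxEP), P (t s) (g (t s)) := by
    filter_upwards [hzP] with s hs
    have h : ∃ y, P (t s) y := ⟨_, hs⟩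
    simp only [g, dif_pos h]
    exact h.choose_spec
  have := (clsEP_eq _ _).1 ((key (fun s => g (t s))).2 hg)
  filter_upwards [this] with s hs using hs.symm

/-- Definability of the last-element-of-`X` relation. -/
theorem relEP (L : FirstOrder.Language) [L.Structure ℤ]
    (hlt : (∅ : Set ℤ).Definable L {v : Fin 2 → ℤ | v 0 < v 1})
    (X : Set ℤ) (hX : (Set.univ : Set ℤ).Definable₁ L X) :
    (Set.univ : Set ℤ).Definable L {v : Fin 2 → ℤ | v 0 ∈ X ∧ v 0 ≤ v 1 ∧
      ∀ c, v 0 < c → c ≤ v 1 → c ∉ X} := by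
  have hl : (Set.univ : Set ℤ).Definable L {v : Fin 2 → ℤ | v 0 < v 1} :=
    hlt.mono (Set.empty_subset _)
  have hX' : (Set.univ : Set ℤ).Definable L {v : Fin 1 → ℤ | v 0 ∈ X} := hX
  have e1 := hX'.preimage_comp (β := Fin 2) ![0]
  have e2 := (hl.preimage_comp (β := Fin 2) ![1, 0]).compl
  have d1 := hl.preimage_comp (β := Fin 3) ![0, 2]
  have d2 := (hl.preimage_comp (β := Fin 3) ![1, 2]).compl
  have d3 := hX'.preimage_comp (β := Fin 3) ![2]
  have e3 := (((d1.inter d2).inter d3).image_comp (![0, 1] : Fin 2 → Fin 3)).compl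
  convert (e1.inter e2).inter e3 using 1
  ext v
  simp only [Set.mem_inter_iff, Set.mem_compl_iff, Set.mem_image, Set.mem_preimage,
    Set.mem_ofPred_eq, Function.comp, Matrix.cons_val_zero, Matrix.cons_val_one,
    not_lt, and_assoc]
  refine and_congr_right fun _ => and_congr_right fun _ => ?_
  constructor
  · rintro h ⟨w, h1, h2, h3, rfl⟩
    exact h (w 2) h1 h2 h3
  · intro h c h1 h2 h3
    refine h ⟨![v 0, v 1, c], h1, h2, h3, ?_⟩
    funext i
    fin_cases i <;> rfl

theorem no_definable_expanding_set (L : FirstOrder.Language) [L.Structure ℤ]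
    (hlt : (∅ : Set ℤ).Definable L {v : Fin 2 → ℤ | v 0 < v 1})
    (hadd : (∅ : Set ℤ).Definable L {v : Fin 3 → ℤ | v 0 + v 1 = v 2})
    (hone : (∅ : Set ℤ).Definable₁ L ({1} : Set ℤ))
    (hEP : HasEP L)
    (X : Set ℤ) (hX : (Set.univ : Set ℤ).Definable₁ L X) :
    ∃ n : ℕ, 1 ≤ n ∧
      {x : ℤ | x ∈ X ∧ ∀ i : ℕ, 1 ≤ i → i ≤ n → x + (i : ℤ) ∉ X}.Finite := by
  classical
  by_contra hcon
  push Not at hcon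
  have hex : ∀ S : IdxEP, ∃ x b : ℤ, (x ∈ X ∧ x ≤ b ∧ ∀ c, x < c → c ≤ b → c ∉ X) ∧
      (∀ f ∈ S, x ≠ f 0) ∧ (∀ f ∈ S, b ≠ f x) := by
    intro S
    have hinf : Set.Infinite _ := hcon (S.card + 1) (by omega)
    obtain ⟨x, ⟨hxX, hgap⟩, hx0⟩ := hinf.exists_notMem_finset (S.image fun f => f 0)
    obtain ⟨b, hb, hb'⟩ := Finset.exists_mem_notMem_of_card_lt_card
      (s := S.image fun f => f x) (t := Finset.Icc x (x + S.card)) (by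
        refine lt_of_le_of_lt Finset.card_image_le ?_
        rw [Int.card_Icc]
        omega)
    rw [Finset.mem_Icc] at hb
    refine ⟨x, b, ⟨hxX, hb.1, fun c h1 h2 => ?_⟩, fun f hf h => ?_, fun f hf h => ?_⟩
    · have := hgap (c - x).toNat (by omega) (by omega)
      rwa [show x + ((c - x).toNat : ℤ) = c by omega] at this
    · exact hx0 (Finset.mem_image.2 ⟨f, hf, h.symm⟩)
    · exact hb' (Finset.mem_image.2 ⟨f, hf, h.symm⟩)
  choose x b hrel hx hb using hex
  let A : Set PowEP := Set.range fun n : ℤ => clsEP fun _ => n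
  have h1 : clsEP x ∈ dcl L PowEP (A ∪ {clsEP b}) := by
    obtain ⟨θ, hθ⟩ := Set.definable_iff_exists_formula_sum.1 (relEP L hlt X hX)
    refine Set.definable_iff_exists_formula_sum.2 ⟨θ.relabel (Sum.elim
      (fun n => Sum.inl ⟨clsEP fun _ => n.1, Or.inl ⟨n.1, rfl⟩⟩)
      ![Sum.inr 0, Sum.inl ⟨clsEP b, Or.inr rfl⟩]), ?_⟩
    ext v
    obtain ⟨z, hz⟩ := clsEP_surj (v 0)
    have hlos := losEP L θ (Sum.elim (fun n => fun _ => n.1) ![z, b])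
    have h4 : ∀ s, (θ.Realize fun i => (Sum.elim (fun n : (Set.univ : Set ℤ) =>
        fun _ : IdxEP => n.1) ![z, b]) i s) ↔ z s = x s := by
      intro s
      have := Set.ext_iff.1 hθ ![z s, b s]
      have h5 : (fun i => (Sum.elim (fun n : (Set.univ : Set ℤ) =>
        fun _ : IdxEP => n.1) ![z, b]) i s) = Sum.elim (↑) ![z s, b s] := by
        funext i
        rcases i with i | i
        · rfl
        · fin_cases i <;> rfl
      rw [h5]
      refine this.symm.trans ?_
      obtain ⟨r1, r2, r3⟩ := hrel s
      change (z s ∈ X ∧ z s ≤ b s ∧ ∀ c, z s < c → c ≤ b s → c ∉ X) ↔ z s = x s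
      constructor
      · rintro ⟨q1, q2, q3⟩
        rcases lt_trichotomy (z s) (x s) with h | h | h
        · exact absurd r1 (q3 _ h r2)
        · exact h
        · exact absurd q1 (r3 _ h q2)
      · intro h
        rw [h]
        exact ⟨r1, r2, r3⟩
    simp only [h4] at hlos
    rw [← clsEP_eq, hz] at hlos
    change v 0 = clsEP x ↔ _
    rw [← hlos]
    change _ ↔ (θ.relabel _).Realize _
    rw [FirstOrder.Language.Formula.realize_relabel]
    apply iff_of_eq
    congr 1
    funext i
    rcases i with i | i
    · rfl
    · fin_cases i
      · exact hz
      · rfl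
  have h2 : clsEP x ∉ dcl L PowEP A := by
    intro h
    obtain ⟨g, hg⟩ := dclEP L A (T := Unit) (fun _ => ()) (by
      rintro p ⟨n, rfl⟩
      exact ⟨fun _ => n, rfl⟩) x h
    obtain ⟨s, hs1, hs2⟩ := (hg.and (ultraEP_mem fun _ => g ())).exists
    exact hx s _ hs2 hs1
  have h3 := hEP PowEP (equivEP L) A _ _ h1 h2
  obtain ⟨g, hg⟩ := dclEP L (A ∪ {clsEP x}) (T := ℤ) x (by
    rintro p (⟨n, rfl⟩ | hp)
    · exact ⟨fun _ => n, rfl⟩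
    · exact ⟨fun m => m, hp⟩) b h3
  obtain ⟨s, hs1, hs2⟩ := (hg.and (ultraEP_mem g)).exists
  exact hb s _ hs2 hs1
end

section
/- Let L be a first-order language equipped with an L-structure on ℤ such that the order relation {(a,b) ∈ ℤ² : a < b}, the graph of addition {(a,b,c) ∈ ℤ³ : a + b = c}, and the singleton {1} are definable without parameters. Then the theory Th(ℤ,L) satisfies the exchange property if and only if every set X ⊆ ℤ that is L-definable with parameters is eventually periodic in both directions, i.e., there exist d ≥ 1 and N ∈ ℕ such that for all x ≥ N, x ∈ X ↔ x + d ∈ X, and for all x ≤ −N, x ∈ X ↔ x − d ∈ X. -/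
open FirstOrder

set_option linter.unusedSectionVars false

section Calculus
open FirstOrder.Language

/-- Types with finitely many integer coordinates. -/
class Crd (T : Type) where
  ι : Type
  fin : Finite ι
  e : T ≃ (ι → ℤ)

attribute [instance] Crd.fin

instance : Crd ℤ := ⟨Unit, inferInstance, (Equiv.funUnique Unit ℤ).symm⟩
instance : Crd Unit := ⟨Empty, inferInstance, ⟨fun _ => Empty.elim, fun _ => (), fun _ => rfl,
  fun _ => funext fun i => i.elim⟩⟩
instance (S T : Type) [Crd S] [Crd T] : Crd (S × T) :=
  ⟨Crd.ι S ⊕ Crd.ι T, inferInstance,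
    (Equiv.prodCongr Crd.e Crd.e).trans (Equiv.sumArrowEquivProdArrow _ _ _).symm⟩
instance (β : Type) [Finite β] : Crd (β → ℤ) := ⟨β, inferInstance, Equiv.refl _⟩

variable (L : Language) [L.Structure ℤ]
variable {S T U : Type} [Crd S] [Crd T] [Crd U]

/-- `P` is definable without parameters. -/
def Dfn (P : S → Prop) : Prop := ∃ φ : L.Formula (Crd.ι S), ∀ g, φ.Realize (Crd.e g) ↔ P g

/-- `f` is a definable function. -/
def DFun (f : S → T) : Prop := Dfn L (fun p : S × T => p.2 = f p.1)

variable {L}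

theorem Dfn.congr {P Q : S → Prop} (h : Dfn L P) (e : ∀ g, P g ↔ Q g) : Dfn L Q := by
  obtain ⟨φ, h⟩ := h
  exact ⟨φ, fun g => (h g).trans (e g)⟩

theorem Dfn.not {P : S → Prop} (h : Dfn L P) : Dfn L (fun g => ¬ P g) := by
  obtain ⟨φ, h⟩ := h
  exact ⟨φ.not, fun g => by rw [Formula.realize_not, h]⟩

theorem Dfn.imp {P Q : S → Prop} (h : Dfn L P) (h' : Dfn L Q) : Dfn L (fun g => P g → Q g) := by
  obtain ⟨φ, h⟩ := h
  obtain ⟨ψ, h'⟩ := h'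
  exact ⟨φ.imp ψ, fun g => by rw [Formula.realize_imp, h, h']⟩

theorem Dfn.and {P Q : S → Prop} (h : Dfn L P) (h' : Dfn L Q) : Dfn L (fun g => P g ∧ Q g) :=
  (h.imp h'.not).not.congr fun g => by tauto

theorem Dfn.or {P Q : S → Prop} (h : Dfn L P) (h' : Dfn L Q) : Dfn L (fun g => P g ∨ Q g) :=
  (h.not.imp h').congr fun g => by tauto

theorem Dfn.iff {P Q : S → Prop} (h : Dfn L P) (h' : Dfn L Q) : Dfn L (fun g => P g ↔ Q g) :=
  ((h.imp h').and (h'.imp h)).congr fun g => by tauto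

theorem Dfn.ex {P : S → T → Prop} (h : Dfn L (fun p : S × T => P p.1 p.2)) :
    Dfn L (fun g => ∃ t, P g t) := by
  obtain ⟨φ, h⟩ := h
  refine ⟨Formula.iExs (Crd.ι T) (α := Crd.ι S) φ, fun g => ?_⟩
  rw [Formula.realize_iExs]
  have key : ∀ t : T, Crd.e (g, t) = Sum.elim (Crd.e g) (Crd.e t) := fun t => by
    funext x
    rcases x with x | x <;> rfl
  constructor
  · rintro ⟨i, hi⟩
    refine ⟨Crd.e.symm i, (h (g, Crd.e.symm i)).1 ?_⟩
    rw [key, Equiv.apply_symm_apply]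
    exact hi
  · rintro ⟨t, ht⟩
    refine ⟨Crd.e t, ?_⟩
    have := (h (g, t)).2 ht
    rw [key] at this
    exact this

theorem Dfn.all {P : S → T → Prop} (h : Dfn L (fun p : S × T => P p.1 p.2)) :
    Dfn L (fun g => ∀ t, P g t) :=
  (Dfn.ex (P := fun g t => ¬ P g t) h.not).not.congr fun g => by simp

theorem Dfn.relabel {P : T → Prop} (h : Dfn L P) (f : S → T) (σ : Crd.ι T → Crd.ι S)
    (hσ : ∀ g i, Crd.e (f g) i = Crd.e g (σ i)) : Dfn L (fun g => P (f g)) := by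
  obtain ⟨φ, h⟩ := h
  refine ⟨Formula.relabel σ φ, fun g => ?_⟩
  rw [Formula.realize_relabel]
  refine Iff.trans ?_ (h (f g))
  have : (Crd.e g ∘ σ) = Crd.e (f g) := by ext i; simp [hσ]
  rw [this]

theorem Dfn.comp {P : T → Prop} (h : Dfn L P) {f : S → T} (hf : DFun L f) :
    Dfn L (fun g => P (f g)) := by
  have h1 : Dfn L (fun p : S × T => P p.2) := h.relabel Prod.snd Sum.inr fun g i => rfl
  exact (Dfn.ex (P := fun g t => t = f g ∧ P t) (hf.and h1)).congr fun g => by simp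

theorem Dfn.coordEq (i j : Crd.ι S) : Dfn L (fun g : S => Crd.e g i = Crd.e g j) :=
  ⟨Term.equal (Term.var i) (Term.var j), fun g => by simp [Formula.realize_equal]⟩

theorem Dfn.true : Dfn L (fun _ : S => True) := ⟨⊤, fun g => by simp⟩
theorem Dfn.const (p : Prop) : Dfn L (fun _ : S => p) := by
  by_cases hp : p
  · exact Dfn.true.congr fun g => by simp [hp]
  · exact Dfn.true.not.congr fun g => by simp [hp]

theorem Dfn.allFin {β : Type*} [Finite β] {P : S → β → Prop} (h : ∀ b, Dfn L (fun g => P g b)) :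
    Dfn L (fun g => ∀ b, P g b) := by
  choose φ h using h
  exact ⟨Formula.iInf φ, fun g => by simp [Formula.realize_iInf, h]⟩

theorem Dfn.exFin {β : Type*} [Finite β] {P : S → β → Prop} (h : ∀ b, Dfn L (fun g => P g b)) :
    Dfn L (fun g => ∃ b, P g b) :=
  (Dfn.allFin fun b => (h b).not).not.congr fun g => by simp

theorem DFun.ofCoord {f : S → T} (σ : Crd.ι T → Crd.ι S)
    (hσ : ∀ g i, Crd.e (f g) i = Crd.e g (σ i)) : DFun L f := by
  refine (Dfn.allFin (β := Crd.ι T) (P := fun (p : S × T) i => Crd.e p.2 i = Crd.e (f p.1) i)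
    fun i => ?_).congr fun g => ?_
  · refine (Dfn.coordEq (S := S × T) (Sum.inr i) (Sum.inl (σ i))).congr fun g => ?_
    rw [hσ]; rfl
  · rw [← funext_iff]; simp

theorem DFun.comp {h : T → U} {f : S → T} (hh : DFun L h) (hf : DFun L f) :
    DFun L (fun g => h (f g)) := by
  have h2 : Dfn L (fun q : (S × U) × T => q.1.2 = h q.2) := 
    Dfn.relabel (P := fun p : T × U => p.2 = h p.1) hh (fun q : (S × U) × T => (q.2, q.1.2))
      (Sum.elim Sum.inr (fun i => Sum.inl (Sum.inr i)))
      (by rintro g (i | i) <;> rfl)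
  have h1 : Dfn L (fun q : (S × U) × T => q.2 = f q.1.1) :=
    Dfn.relabel (P := fun p : S × T => p.2 = f p.1) hf (fun q : (S × U) × T => (q.1.1, q.2))
      (Sum.elim (fun i => Sum.inl (Sum.inl i)) Sum.inr)
      (by rintro g (i | i) <;> rfl)
  exact (Dfn.ex (P := fun (g : S × U) t => t = f g.1 ∧ g.2 = h t) (h1.and h2)).congr
    fun g => by simp

theorem DFun.id : DFun L (fun g : S => g) := DFun.ofCoord (fun i => i) fun _ _ => rfl
theorem DFun.fst {f : S → T × U} (h : DFun L f) : DFun L (fun g => (f g).1) :=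
  DFun.comp (h := Prod.fst) (DFun.ofCoord Sum.inl fun _ _ => rfl) h
theorem DFun.snd {f : S → T × U} (h : DFun L f) : DFun L (fun g => (f g).2) :=
  DFun.comp (h := Prod.snd) (DFun.ofCoord Sum.inr fun _ _ => rfl) h
theorem DFun.eval {β : Type} [Finite β] {f : S → β → ℤ} (h : DFun L f) (b : β) :
    DFun L (fun g => f g b) :=
  DFun.comp (h := fun v : β → ℤ => v b) (DFun.ofCoord (fun _ => b) fun _ _ => rfl) h

theorem DFun.pair {f : S → T} {h : S → U} (hf : DFun L f) (hh : DFun L h) :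
    DFun L (fun g => (f g, h g)) := by
  have h1 : Dfn L (fun q : S × (T × U) => q.2.1 = f q.1) :=
    Dfn.comp (P := fun p : S × T => p.2 = f p.1) hf (f := fun q : S × (T × U) => (q.1, q.2.1))
      (DFun.ofCoord (Sum.elim Sum.inl (fun i => Sum.inr (Sum.inl i)))
      (by rintro g (i | i) <;> rfl))
  have h2 : Dfn L (fun q : S × (T × U) => q.2.2 = h q.1) :=
    Dfn.comp (P := fun p : S × U => p.2 = h p.1) hh (f := fun q : S × (T × U) => (q.1, q.2.2))
      (DFun.ofCoord (Sum.elim Sum.inl (fun i => Sum.inr (Sum.inr i)))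
      (by rintro g (i | i) <;> rfl))
  exact (h1.and h2).congr fun g => by rw [Prod.ext_iff]

theorem DFun.pi {β : Type} [Finite β] {f : S → β → ℤ} (hf : ∀ b, DFun L (fun g => f g b)) :
    DFun L (fun g => f g) := by
  have h1 : ∀ b, Dfn L (fun q : S × (β → ℤ) => q.2 b = f q.1 b) := fun b =>
    Dfn.comp (P := fun p : S × ℤ => p.2 = f p.1 b) (hf b)
      (f := fun q : S × (β → ℤ) => (q.1, q.2 b))
      (DFun.ofCoord (Sum.elim Sum.inl (fun _ => Sum.inr b))
      (by rintro g (i | i) <;> rfl))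
  exact (Dfn.allFin h1).congr fun g => by rw [funext_iff]

theorem Dfn.eq {f h : S → T} (hf : DFun L f) (hh : DFun L h) : Dfn L (fun g => f g = h g) :=
  Dfn.comp (P := fun p : S × T => p.2 = h p.1) hh (f := fun g => (g, f g)) (DFun.id.pair hf)

theorem DFun.of_dfn {f : S → T} (h : Dfn L (fun p : S × T => p.2 = f p.1)) : DFun L f := h

/-- the arithmetic that is available -/
class Arith (L : Language) [L.Structure ℤ] : Prop where
  lt : Dfn L (fun p : ℤ × ℤ => p.1 < p.2)
  add : DFun L (fun p : ℤ × ℤ => p.1 + p.2)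
  one : DFun L (fun _ : Unit => (1 : ℤ))

variable [Arith L]
set_option linter.unusedSectionVars false

theorem Dfn.lt {f h : S → ℤ} (hf : DFun L f) (hh : DFun L h) : Dfn L (fun g => f g < h g) :=
  Arith.lt.comp (hf.pair hh)
theorem Dfn.le {f h : S → ℤ} (hf : DFun L f) (hh : DFun L h) : Dfn L (fun g => f g ≤ h g) :=
  (Dfn.lt hh hf).not.congr fun g => by simp
theorem DFun.add {f h : S → ℤ} (hf : DFun L f) (hh : DFun L h) : DFun L (fun g => f g + h g) :=
  Arith.add.comp (hf.pair hh)
theorem DFun.sub {f h : S → ℤ} (hf : DFun L f) (hh : DFun L h) : DFun L (fun g => f g - h g) := by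
  have h1 : Dfn L (fun p : S × ℤ => p.2 + h p.1 = f p.1) :=
    Dfn.eq (DFun.add DFun.id.snd (hh.comp DFun.id.fst)) (hf.comp DFun.id.fst)
  exact h1.congr fun g => by constructor <;> intro h <;> linarith
theorem DFun.one : DFun L (fun _ : S => (1 : ℤ)) :=
  Arith.one.comp (f := fun _ : S => ()) (DFun.ofCoord Empty.elim fun _ i => i.elim)
theorem DFun.zero : DFun L (fun _ : S => (0 : ℤ)) := by
  simpa using DFun.sub (DFun.one (L := L) (S := S)) DFun.one
theorem DFun.neg {f : S → ℤ} (hf : DFun L f) : DFun L (fun g => - f g) := by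
  simpa using DFun.sub DFun.zero hf
theorem DFun.natMul {f : S → ℤ} (hf : DFun L f) (n : ℕ) : DFun L (fun g => (n : ℤ) * f g) := by
  induction n with
  | zero => simpa using DFun.zero
  | succ n ih => simpa [add_mul] using ih.add hf
theorem DFun.mulc {f : S → ℤ} (hf : DFun L f) (n : ℤ) : DFun L (fun g => n * f g) := by
  obtain ⟨n, rfl | rfl⟩ := n.eq_nat_or_neg
  · exact hf.natMul n
  · simpa using (hf.natMul n).neg
theorem DFun.const (n : ℤ) : DFun L (fun _ : S => n) := by
  simpa using DFun.mulc (DFun.one (L := L) (S := S)) n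
theorem DFun.constv {β : Type} [Finite β] (n : β → ℤ) : DFun L (fun _ : S => n) :=
  DFun.pi fun b => DFun.const (n b)
theorem DFun.addv {β : Type} [Finite β] {f h : S → β → ℤ} (hf : DFun L f) (hh : DFun L h) :
    DFun L (fun g => f g + h g) := DFun.pi fun b => (hf.eval b).add (hh.eval b)
theorem DFun.subv {β : Type} [Finite β] {f h : S → β → ℤ} (hf : DFun L f) (hh : DFun L h) :
    DFun L (fun g => f g - h g) := DFun.pi fun b => (hf.eval b).sub (hh.eval b)
theorem Dfn.dvd {f : S → ℤ} (hf : DFun L f) (n : ℤ) : Dfn L (fun g => n ∣ f g) :=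
  Dfn.ex (P := fun g t => f g = n * t) (Dfn.eq (hf.comp DFun.id.fst) (DFun.id.snd.mulc n))
theorem Dfn.absle {f h : S → ℤ} (hf : DFun L f) (hh : DFun L h) : Dfn L (fun g => |f g| ≤ h g) :=
  ((Dfn.le hh.neg hf).and (Dfn.le hf hh)).congr fun g => by rw [abs_le]


theorem DFun.coord (i : Crd.ι S) : DFun L (fun g : S => Crd.e g i) :=
  DFun.ofCoord (fun _ => i) fun _ _ => rfl

theorem DFun.constT (c : T) : DFun L (fun _ : S => c) := by
  refine Dfn.congr (P := fun p : S × T => ∀ i, Crd.e p.2 i = Crd.e c i)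
    (Dfn.allFin fun i => Dfn.eq ((DFun.coord i).comp DFun.id.snd) (DFun.const _)) fun p => ?_
  rw [← funext_iff]; simp

/-- Automation: prove definability goals by structural decomposition. -/
theorem dfn {P : S → Prop} (h : Dfn L P := by
  repeat' first
    | with_reducible exact DFun.id
    | with_reducible assumption
    | intro _
    | with_reducible apply Dfn.imp | with_reducible apply Dfn.and | with_reducible apply Dfn.or
    | with_reducible apply Dfn.iff | with_reducible apply Dfn.not
    | with_reducible apply Dfn.absle | with_reducible apply Dfn.le | with_reducible apply Dfn.lt
    | with_reducible apply Dfn.eq | with_reducible apply Dfn.dvd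
    | with_reducible apply Dfn.ex | with_reducible apply Dfn.all
    | with_reducible apply Dfn.exFin | with_reducible apply Dfn.allFin
    | with_reducible apply Dfn.const
    | with_reducible apply DFun.constT
    | with_reducible apply DFun.add | with_reducible apply DFun.sub
    | with_reducible apply DFun.mulc | with_reducible apply DFun.neg
    | with_reducible apply DFun.addv | with_reducible apply DFun.subv
    | with_reducible apply DFun.fst | with_reducible apply DFun.snd
    | with_reducible apply DFun.pair | with_reducible apply DFun.eval
    | (with_reducible refine Dfn.comp (by with_reducible assumption) ?_)
    | (with_reducible refine DFun.comp (by with_reducible assumption) ?_)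
    | with_reducible apply DFun.pi) : Dfn L P := h


end Calculus

section Minimal
open FirstOrder.Language
variable {L : Language} [L.Structure ℤ] [Arith L]
variable {S T U : Type} [Crd S] [Crd T] [Crd U]

/-- minimality at `+∞` -/
def Mnl (L : Language) [L.Structure ℤ] : Prop :=
  ∀ P : ℤ → Prop, Dfn L P → ∃ d : ℤ, 1 ≤ d ∧ ∃ N : ℤ, ∀ x, N ≤ x → (P x ↔ P (x + d))

/-- Linear growth. -/
theorem lemA (H : Mnl L) {R : ℤ × ℤ → Prop} (hR : Dfn L R)
    (hb : ∀ x, 1 ≤ x → ∃ B, ∀ y, R (x, y) → y ≤ B) :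
    ∃ C : ℤ, 0 < C ∧ ∀ x, 1 ≤ x → ∀ y, R (x, y) → y ≤ C * x := by
  let G : ℤ × ℤ → Prop := fun p => p.2 = 0 ∨ ∃ m, 1 ≤ m ∧ m ≤ p.1 ∧ R (m, p.2)
  have hG : Dfn L G := dfn
  let I : ℤ × ℤ → Prop := fun p => G (p.1, p.2) ∧ ∀ y, G (p.1, y) → y ≤ p.2
  have hI : Dfn L I := dfn
  have hbd : ∀ n : ℕ, ∃ B, ∀ y, G (n, y) → y ≤ B := by
    intro n
    induction n with
    | zero =>
      refine ⟨0, ?_⟩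
      rintro y (h | ⟨m, h1, h2, _⟩)
      · exact h.le
      · simp at h2; omega
    | succ n ih =>
      obtain ⟨B, hB⟩ := ih
      obtain ⟨B', hB'⟩ := hb (n + 1) (by omega)
      refine ⟨max B B', ?_⟩
      rintro y (h | ⟨m, h1, h2, h3⟩)
      · exact (hB y (Or.inl h)).trans (le_max_left _ _)
      · push_cast at h2
        rcases h2.lt_or_eq with h4 | h4
        · exact (hB y (Or.inr ⟨m, h1, by simp; omega, h3⟩)).trans (le_max_left _ _)
        · simp at h3 h4
          rw [h4] at h3
          exact (hB' y h3).trans (le_max_right _ _)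
  have hex : ∀ n : ℕ, ∃ y, I (n, y) := fun n =>
    Int.exists_greatest_of_bdd (hbd n) ⟨0, Or.inl rfl⟩
  choose g hg using hex
  have hmono : ∀ m n, m ≤ n → g m ≤ g n := by
    intro m n h
    refine (hg n).2 _ ?_
    rcases (hg m).1 with h1 | ⟨k, h1, h2, h3⟩
    · exact Or.inl h1
    · refine Or.inr ⟨k, h1, ?_, h3⟩
      simp at h2 ⊢; omega
  let Y : ℤ → Prop := fun y => ∃ n, 0 ≤ n ∧ I (n, y)
  have hY : Dfn L Y := dfn
  obtain ⟨d, hd, N, hN⟩ := H Y hY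
  have hYg : ∀ n, Y (g n) := fun n => ⟨n, by simp, hg n⟩
  have hgY : ∀ y, Y y → ∃ n, y = g n := by
    rintro y ⟨n, h0, hn⟩
    lift n to ℕ using h0
    exact ⟨n, le_antisymm ((hg n).2 _ hn.1) (hn.2 _ (hg n).1)⟩
  have hstep : ∀ n, N ≤ g n → g (n + 1) ≤ g n + d := by
    intro n hn
    obtain ⟨m, hm⟩ := hgY _ ((hN _ hn).1 (hYg n))
    rw [hm]
    apply hmono
    by_contra hlt
    have := hmono m n (by omega)
    omega
  have hRg : ∀ n : ℕ, 1 ≤ n → ∀ y, R (n, y) → y ≤ g n := fun n hn y hy =>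
    (hg n).2 y (Or.inr ⟨n, by omega, le_rfl, hy⟩)
  have h0 : ∀ n, 0 ≤ g n := fun n => (hg n).2 0 (Or.inl rfl)
  by_cases hc : ∃ n, N ≤ g n
  · obtain ⟨n0, hn0⟩ := hc
    have hlin : ∀ k : ℕ, g (n0 + k) ≤ g n0 + d * k := by
      intro k
      induction k with
      | zero => simp
      | succ k ih =>
        have := hstep (n0 + k) (hn0.trans (hmono _ _ (by omega)))
        rw [← add_assoc]; push_cast; linarith
    refine ⟨g n0 + d, by linarith [h0 n0], fun x hx y hy => ?_⟩
    lift x to ℕ using by omega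
    have h1 := hRg x (by omega) y hy
    have h2 : g x ≤ g (n0 + x) := hmono _ _ (by omega)
    have h3 := hlin x
    nlinarith [h0 n0]
  · push Not at hc
    have hN0 : 0 < N := (h0 0).trans_lt (hc 0)
    refine ⟨N, hN0, fun x hx y hy => ?_⟩
    lift x to ℕ using by omega
    have h1 := hRg x (by omega) y hy
    have := hc x
    nlinarith

/-- uniform periods -/
theorem lemB (H : Mnl L) {P : S × ℤ → Prop} (hP : Dfn L P) :
    ∃ d : ℤ, 1 ≤ d ∧ ∀ c, ∃ N : ℤ, ∀ x, N ≤ x → (P (c, x) ↔ P (c, x + d)) := by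
  let Per : S × ℤ → Prop := fun q => ∃ N : ℤ, ∀ x, N ≤ x → (P (q.1, x) ↔ P (q.1, x + q.2))
  have hPer : Dfn L Per := dfn
  have hsub : ∀ c, ∃ G : AddSubgroup ℤ, ∀ e, e ∈ G ↔ Per (c, e) := by
    intro c
    have hs : ∀ e e', Per (c, e) → Per (c, e') → Per (c, e - e') := by
      rintro e e' ⟨N, hN⟩ ⟨N', hN'⟩
      refine ⟨max N N' + |e| + |e'|, fun x hx => ?_⟩
      simp only at hN hN' hx ⊢
      have h1 := le_max_left N N'
      have h2 := le_max_right N N'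
      have h3 := neg_abs_le e
      have h4 := le_abs_self e'
      have h5 := abs_nonneg e
      have h6 := abs_nonneg e'
      rw [hN x (by linarith), hN' (x + (e - e')) (by linarith)]
      ring_nf
    exact ⟨AddSubgroup.ofSub {e | Per (c, e)} ⟨0, 0, fun x _ => by simp⟩
      (fun x hx y hy => by
        have := hs x y hx hy
        rwa [sub_eq_add_neg] at this), fun e => Iff.rfl⟩
  choose G hG using hsub
  let Mi : S × ℤ → Prop := fun q => 1 ≤ q.2 ∧ Per q ∧ ∀ y, 1 ≤ y → Per (q.1, y) → q.2 ≤ y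
  have hMi : Dfn L Mi := dfn
  have hdvd : ∀ c x y, Mi (c, x) → Per (c, y) → x ∣ y := by
    rintro c x y ⟨h1, h2, h3⟩ hy
    simp only at h1 h3
    have hr : Per (c, y % x) := by
      rw [← hG] at h2 hy ⊢
      rw [Int.emod_def]
      exact sub_mem hy (by rw [mul_comm, ← smul_eq_mul]; exact (G c).zsmul_mem h2 _)
    by_contra hn
    have h4 : y % x ≠ 0 := fun h => hn (Int.dvd_of_emod_eq_zero h)
    have h5 := Int.emod_nonneg y (show x ≠ 0 by omega)
    have h6 := Int.emod_lt_of_pos y (show 0 < x by omega)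
    have := h3 _ (by omega) hr
    omega
  have hmul : ∀ c x y, Mi (c, x) → x ∣ y → Per (c, y) := by
    rintro c x _ ⟨h1, h2, h3⟩ ⟨z, rfl⟩
    rw [← hG] at h2 ⊢
    rw [mul_comm, ← smul_eq_mul]; exact (G c).zsmul_mem h2 _
  have hMex : ∀ c, ∃ x, Mi (c, x) := by
    intro c
    have hPc : Dfn L (fun x : ℤ => P (c, x)) := by
      have := DFun.constT (L := L) (S := ℤ) c
      exact dfn
    obtain ⟨d, hd, N, hN⟩ := H _ hPc
    obtain ⟨x, ⟨h1, h2⟩, h3⟩ := Int.exists_least_of_bdd (P := fun y => 1 ≤ y ∧ Per (c, y))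
      ⟨1, fun z hz => hz.1⟩ ⟨d, hd, N, hN⟩
    exact ⟨x, h1, h2, fun y hy hy' => h3 y ⟨hy, hy'⟩⟩
  let D : ℤ → Prop := fun x => ∃ c, Mi (c, x)
  have hD : Dfn L D := dfn
  by_cases hbd : ∃ B : ℤ, ∀ x, D x → x ≤ B
  · obtain ⟨B, hB⟩ := hbd
    refine ⟨(B.toNat.factorial : ℤ), by exact_mod_cast Nat.factorial_pos _, fun c => ?_⟩
    obtain ⟨x, hx⟩ := hMex c
    apply hmul c x _ hx
    have h1 := hx.1
    have h2 := hB x ⟨c, hx⟩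
    simp only at h1
    lift x to ℕ using by omega
    exact_mod_cast Nat.dvd_factorial (by omega) (by omega)
  · exfalso
    push Not at hbd
    obtain ⟨k, hk, N, hN⟩ := H D hD
    let Q : ℤ × ℤ → Prop := fun q => 1 ≤ q.2 ∧ ∃ c c', Mi (c, q.1) ∧ Mi (c', q.1 + k) ∧
      Per (c, q.2) ∧ Per (c', q.2) ∧
        ∀ y, 1 ≤ y → Per (c, y) → Per (c', y) → q.2 ≤ y
    have hQ : Dfn L Q := dfn
    obtain ⟨C, hC, hCQ⟩ := lemA H hQ (by
      intro x hx
      refine ⟨x * (x + k), ?_⟩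
      rintro y ⟨h1, c, c', h2, h3, h4, h5, h6⟩
      refine h6 _ ?_ (hmul _ _ _ h2 (Dvd.intro _ rfl)) (hmul _ _ _ h3 (Dvd.intro_left _ rfl))
      nlinarith)
    obtain ⟨x, hx, hxB⟩ := hbd (max N (k * C + 1))
    have hx1 := le_max_left N (k * C + 1)
    have hx2 := le_max_right N (k * C + 1)
    obtain ⟨c, hc⟩ := hx
    obtain ⟨c', hc'⟩ := (hN x (by omega)).1 ⟨c, hc⟩
    have hxp : 1 ≤ x := hc.1
    obtain ⟨y, ⟨h1, h2, h3⟩, h4⟩ := Int.exists_least_of_bdd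
      (P := fun y => 1 ≤ y ∧ Per (c, y) ∧ Per (c', y))
      ⟨1, fun z hz => hz.1⟩ ⟨x * (x + k), by nlinarith, hmul _ _ _ hc (Dvd.intro _ rfl),
        hmul _ _ _ hc' (Dvd.intro_left _ rfl)⟩
    have h5 := hCQ x hxp y ⟨h1, c, c', hc, hc', h2, h3, fun z z1 z2 z3 => h4 z ⟨z1, z2, z3⟩⟩
    obtain ⟨a, ha⟩ := hdvd _ _ _ hc h2
    obtain ⟨b, hb⟩ := hdvd _ _ _ hc' h3
    have hb0 : 1 ≤ b := by by_contra h; nlinarith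
    have hbC : b ≤ C := by by_contra h; nlinarith
    have h6 : x * (a - b) = k * b := by linarith
    have h7 : 1 ≤ a - b := by by_contra h; nlinarith
    nlinarith

/-- `f` has slope `w` with respect to the step `D`. -/
def Slope {T : Type} [Add T] (f : ℤ → T) (D : ℤ) (w : T) : Prop :=
  ∃ N : ℤ, ∀ x, N ≤ x → D ∣ x → f (x + D) = f x + w

theorem Slope.iter {T : Type} [AddCommGroup T] {f : ℤ → T} {D : ℤ} (hD : 1 ≤ D) {w : T}
    (h : Slope f D w) (n : ℕ) :
    ∃ N : ℤ, ∀ x, N ≤ x → D ∣ x → f (x + D * n) = f x + n • w := by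
  obtain ⟨N, hN⟩ := h
  refine ⟨N, fun x hx hDx => ?_⟩
  induction n with
  | zero => simp
  | succ n ih =>
    have h1 := hN (x + D * n) (by nlinarith) (dvd_add hDx (Dvd.intro _ rfl))
    rw [show x + D * ((n + 1 : ℕ) : ℤ) = x + D * n + D by push_cast; ring, h1, ih, succ_nsmul,
      add_assoc]

theorem Slope.mul {T : Type} [AddCommGroup T] {f : ℤ → T} {D : ℤ} (hD : 1 ≤ D) {w : T}
    (h : Slope f D w) (n : ℕ) : Slope f (D * n) (n • w) := by
  obtain ⟨N, hN⟩ := h.iter hD n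
  exact ⟨N, fun x hx hdx => hN x hx ((Dvd.intro _ rfl).trans hdx)⟩

theorem growth {g : ℤ → ℤ} {C D y : ℤ} (hD : 1 ≤ D) (hg : ∀ x, 1 ≤ x → g x ≤ C * x)
    (h : ∃ N : ℤ, ∀ x, N ≤ x → D ∣ x → g x + y ≤ g (x + D)) : y ≤ C * D := by
  obtain ⟨N, hN⟩ := h
  set x := D * (|N| + 1) with hx
  have hx1 : 1 ≤ x := by have := abs_nonneg N; nlinarith
  have hxN : N ≤ x := by have := abs_nonneg N; have := le_abs_self N; nlinarith
  have hit : ∀ j : ℕ, g x + j * y ≤ g (x + D * j) := by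
    intro j
    induction j with
    | zero => simp
    | succ j ih =>
      have h1 := hN (x + D * j) (by nlinarith) (dvd_add (Dvd.intro _ rfl) (Dvd.intro _ rfl))
      rw [show x + D * ((j + 1 : ℕ) : ℤ) = x + D * j + D by push_cast; ring]
      push_cast; linarith
  by_contra hc
  have h1 := hit (|C * x - g x| + 1).toNat
  have h2 : (((|C * x - g x| + 1).toNat : ℕ) : ℤ) = |C * x - g x| + 1 :=
    Int.toNat_of_nonneg (by positivity)
  rw [h2] at h1
  have h3 := hg (x + D * (|C * x - g x| + 1)) (by
    have : 0 ≤ D * (|C * x - g x| + 1) := by positivity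
    linarith)
  have h4 := le_abs_self (C * x - g x)
  have h5 := abs_nonneg (C * x - g x)
  nlinarith

theorem slope_exists (H : Mnl L) {f : S × ℤ → ℤ} (hf : DFun L f) :
    ∃ D : ℤ, 1 ≤ D ∧ ∀ c, ∃ w, Slope (fun x => f (c, x)) D w := by
  let P : (S × ℤ × ℤ) × ℤ → Prop := fun q =>
    f (q.1.1, q.2) + q.1.2.2 ≤ f (q.1.1, q.2 + q.1.2.1)
  have hP : Dfn L P := dfn
  obtain ⟨D, hD, hper⟩ := lemB H hP
  refine ⟨D, hD, fun c => ?_⟩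
  have hfc : DFun L (fun x : ℤ => f (c, x)) := hf.comp ((DFun.constT c).pair DFun.id)
  obtain ⟨C, hC, hC1⟩ := lemA H (R := fun p => p.2 = f (c, p.1)) hfc
    fun x hx => ⟨f (c, x), fun y hy => hy.le⟩
  obtain ⟨C', hC', hC1'⟩ := lemA H (R := fun p => p.2 = - f (c, p.1)) hfc.neg
    fun x hx => ⟨- f (c, x), fun y hy => hy.le⟩
  let E : ℤ → Prop := fun y => ∃ N : ℤ, ∀ x, N ≤ x → D ∣ x → f (c, x) + y ≤ f (c, x + D)
  have hE : ∀ y, ¬ E y → ∃ N : ℤ, ∀ x, N ≤ x → D ∣ x → f (c, x + D) < f (c, x) + y := by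
    intro y hy
    obtain ⟨N, hN⟩ := hper (c, D, y)
    refine ⟨N, fun x hx hDx => ?_⟩
    by_contra hlt
    push Not at hlt
    refine hy ⟨x, fun x' hx' hDx' => ?_⟩
    obtain ⟨j, hj⟩ : D ∣ x' - x := dvd_sub hDx' hDx
    obtain rfl : x' = x + D * j := by linarith
    have hj0 : 0 ≤ j := by by_contra h; nlinarith
    lift j to ℕ using hj0
    clear hj hx' hDx'
    induction j with
    | zero => simpa using hlt
    | succ j ih =>
      have h2 := (hN (x + D * j) (by nlinarith)).1 ih
      rw [show x + D * ((j + 1 : ℕ) : ℤ) = x + D * j + D by push_cast; ring]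
      exact h2
  obtain ⟨w, hw, hw'⟩ := Int.exists_greatest_of_bdd (P := E)
    ⟨C * D, fun y hy => growth (g := fun x => f (c, x)) hD (fun x hx => hC1 x hx _ rfl) hy⟩
    (by
      by_contra hne
      push Not at hne
      obtain ⟨N, hN⟩ := hE _ (hne (-(C' * D + 1)))
      have := growth (g := fun x => - f (c, x)) (y := C' * D + 1) hD
        (fun x hx => hC1' x hx _ rfl) ⟨N, fun x hx hx' => by
          have := hN x hx hx'
          linarith⟩
      linarith)
  refine ⟨w, ?_⟩
  obtain ⟨N, hN⟩ := hw
  obtain ⟨N', hN'⟩ := hE (w + 1) fun h => by have := hw' _ h; omega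
  refine ⟨max N N', fun x hx hx' => ?_⟩
  have h1 := hN x (le_of_max_le_left hx) hx'
  have h2 := hN' x (le_of_max_le_right hx) hx'
  simp only
  omega

theorem slope_bdd (H : Mnl L) {f : S × ℤ → ℤ} (hf : DFun L f) {D : ℤ} (hD : 1 ≤ D) :
    ∃ B : ℤ, ∀ c w, Slope (fun x => f (c, x)) D w → w ≤ B := by
  let R : ℤ × ℤ → Prop := fun q => ∃ c,
    (∃ N : ℤ, ∀ x, N ≤ x → D ∣ x → f (c, x + D) = f (c, x) + q.1) ∧
    (∃ N : ℤ, ∀ x, N ≤ x → D ∣ x → f (c, x + D * q.1) = f (c, x) + q.2)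
  have hR : Dfn L R := dfn
  obtain ⟨C, hC, hCR⟩ := lemA H hR (by
    intro w hw
    refine ⟨w * w, ?_⟩
    rintro y ⟨c, h1, N, hN⟩
    lift w to ℕ using by omega
    obtain ⟨N', hN'⟩ := Slope.iter (f := fun x => f (c, x)) hD h1 w
    set x := D * (|N| + |N'|) with hx
    have a1 := abs_nonneg N
    have a2 := abs_nonneg N'
    have a3 := le_abs_self N
    have a4 := le_abs_self N'
    have h2 := hN x (by nlinarith) (Dvd.intro _ rfl)
    have h3 := hN' x (by nlinarith) (Dvd.intro _ rfl)
    simp at h2 h3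
    linarith)
  refine ⟨C, fun c w hw => ?_⟩
  by_cases h0 : 1 ≤ w
  · have h2 := hCR w h0 (w * w) ⟨c, hw, by
      lift w to ℕ using by omega
      obtain ⟨N', hN'⟩ := Slope.iter hD hw w
      exact ⟨N', fun x hx hDx => by simpa using hN' x hx hDx⟩⟩
    nlinarith
  · linarith

theorem lemCD (H : Mnl L) {f : S × ℤ → ℤ} (hf : DFun L f) :
    ∃ D : ℤ, 1 ≤ D ∧ ∃ B : ℤ, ∀ c, ∃ w, |w| ≤ B ∧ Slope (fun x => f (c, x)) D w := by
  obtain ⟨D, hD, h⟩ := slope_exists H hf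
  obtain ⟨B, hB⟩ := slope_bdd H hf hD
  obtain ⟨B', hB'⟩ := slope_bdd H hf.neg hD
  refine ⟨D, hD, max B B', fun c => ?_⟩
  obtain ⟨w, hw⟩ := h c
  refine ⟨w, abs_le.2 ⟨?_, (hB c w hw).trans (le_max_left _ _)⟩, hw⟩
  have := hB' c (-w) (by
    obtain ⟨N, hN⟩ := hw
    refine ⟨N, fun x hx hx' => ?_⟩
    have := hN x hx hx'
    simp only at this ⊢; rw [this]; ring)
  have h2 := le_max_right B B'
  linarith

theorem lemCDv {β : Type} [Fintype β] (H : Mnl L) {f : S × ℤ → β → ℤ} (hf : DFun L f) :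
    ∃ D : ℤ, 1 ≤ D ∧ ∃ B : ℤ, ∀ c, ∃ w : β → ℤ, (∀ b, |w b| ≤ B) ∧
      Slope (fun x => f (c, x)) D w := by
  classical
  choose D hD B hB using fun b => lemCD H (hf.eval b)
  have hpos : ∀ s : Finset β, 1 ≤ ∏ b ∈ s, D b := fun s =>
    Int.add_one_le_iff.2 (Finset.prod_pos fun b _ => by linarith [hD b])
  refine ⟨∏ b, D b, hpos _, ∑ b, (∏ b, D b) * |B b|, fun c => ?_⟩
  choose w hw hw' using fun b => hB b c
  have key : ∀ b, Slope (fun x => f (c, x) b) (∏ b, D b)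
      ((∏ b ∈ Finset.univ.erase b, D b).toNat • w b) := by
    intro b
    have h1 := (hw' b).mul (hD b) (∏ b ∈ Finset.univ.erase b, D b).toNat
    rwa [Int.toNat_of_nonneg (by linarith [hpos (Finset.univ.erase b)]),
      Finset.mul_prod_erase _ _ (Finset.mem_univ b)] at h1
  refine ⟨fun b => (∏ b ∈ Finset.univ.erase b, D b).toNat • w b, ?_, ?_⟩
  · intro b
    have h1 := hpos (Finset.univ.erase b)
    beta_reduce
    rw [nsmul_eq_mul, Int.toNat_of_nonneg (by linarith), abs_mul, abs_of_pos (by linarith)]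
    refine le_trans ?_ (Finset.single_le_sum (f := fun b => (∏ b, D b) * |B b|) (fun b _ => ?_)
      (Finset.mem_univ b))
    · have h2 : ∏ b ∈ Finset.univ.erase b, D b ≤ ∏ b, D b := by
        rw [← Finset.mul_prod_erase _ D (Finset.mem_univ b)]
        nlinarith [hD b]
      exact mul_le_mul h2 ((hw b).trans (le_abs_self _)) (abs_nonneg _) (by linarith)
    · have := hpos Finset.univ
      positivity
  · choose N hN using key
    refine ⟨∑ b, |N b|, fun x hx hx' => funext fun b => hN b x (le_trans ?_ hx) hx'⟩
    exact (le_abs_self _).trans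
      (Finset.single_le_sum (f := fun b => |N b|) (fun b _ => abs_nonneg _) (Finset.mem_univ b))

end Minimal

section Muchnik
open FirstOrder.Language
variable {L : Language} [L.Structure ℤ] [Arith L]
variable {S T U : Type} [Crd S] [Crd T] [Crd U]

/-- definable choice for `T` -/
def Skol (L : Language) [L.Structure ℤ] (T : Type) [Crd T] : Prop :=
  ∀ (S : Type) [Crd S] (R : S × T → Prop), Dfn L R →
    ∃ F : S → T, DFun L F ∧ ∀ c, (∃ y, R (c, y)) → R (c, F c)

theorem Skol.int : Skol L ℤ := by
  intro S _ R hR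
  let G : S × ℤ → Prop := fun p =>
    (0 ≤ p.2 ∧ R p ∧ ∀ z, 0 ≤ z → R (p.1, z) → p.2 ≤ z) ∨
    ((¬ ∃ z, 0 ≤ z ∧ R (p.1, z)) ∧ R p ∧ ∀ z, R (p.1, z) → z ≤ p.2) ∨
    ((¬ ∃ z, R (p.1, z)) ∧ p.2 = 0)
  have hG : Dfn L G := dfn
  have hex : ∀ c, ∃ y, G (c, y) := by
    intro c
    by_cases h1 : ∃ z, 0 ≤ z ∧ R (c, z)
    · obtain ⟨y, hy, hy'⟩ := Int.exists_least_of_bdd (P := fun z => 0 ≤ z ∧ R (c, z))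
        ⟨0, fun z hz => hz.1⟩ h1
      exact ⟨y, Or.inl ⟨hy.1, hy.2, fun z h h' => hy' z ⟨h, h'⟩⟩⟩
    · by_cases h2 : ∃ z, R (c, z)
      · obtain ⟨y, hy, hy'⟩ := Int.exists_greatest_of_bdd (P := fun z => R (c, z))
          ⟨0, fun z hz => by by_contra h; exact h1 ⟨z, by omega, hz⟩⟩ h2
        exact ⟨y, Or.inr (Or.inl ⟨h1, hy, hy'⟩)⟩
      · exact ⟨0, Or.inr (Or.inr ⟨h2, rfl⟩)⟩
  choose F hF using hex
  refine ⟨F, hG.congr ?_, ?_⟩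
  · rintro ⟨c, y⟩
    constructor
    · intro hy
      rcases hF c with ⟨a, b, h⟩ | ⟨a, b, h⟩ | ⟨a, b⟩ <;>
        rcases hy with ⟨a', b', h'⟩ | ⟨a', b', h'⟩ | ⟨a', b'⟩
      · exact le_antisymm (h' _ a b) (h _ a' b')
      · exact absurd ⟨_, a, b⟩ a'
      · exact absurd ⟨_, b⟩ a'
      · exact absurd ⟨_, a', b'⟩ a
      · exact le_antisymm (h _ b') (h' _ b)
      · exact absurd ⟨_, b⟩ a'
      · exact absurd ⟨_, b'⟩ a
      · exact absurd ⟨_, b'⟩ a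
      · exact b'.trans b.symm
    · intro h
      simp only at h
      rw [h]
      exact hF c
  · rintro c hy
    rcases hF c with ⟨a, b, h⟩ | ⟨a, b, h⟩ | ⟨a, b⟩
    · exact b
    · exact b
    · exact absurd hy a

theorem Skol.prod (hT : Skol L T) (hU : Skol L U) : Skol L (T × U) := by
  intro S _ R hR
  obtain ⟨F, hF, hF'⟩ := hT S (fun p => ∃ u, R (p.1, (p.2, u))) dfn
  obtain ⟨G, hG, hG'⟩ := hU S (fun p => R (p.1, (F p.1, p.2))) dfn
  refine ⟨fun c => (F c, G c), hF.pair hG, ?_⟩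
  rintro c ⟨⟨t, u⟩, h⟩
  exact hG' c (hF' c ⟨t, u, h⟩)

theorem Skol.surj (hT : Skol L T) {g : T → U} (hg : DFun L g) (hs : Function.Surjective g) :
    Skol L U := by
  intro S _ R hR
  obtain ⟨F, hF, hF'⟩ := hT S (fun p => R (p.1, g p.2)) dfn
  refine ⟨fun c => g (F c), hg.comp hF, ?_⟩
  rintro c ⟨u, h⟩
  obtain ⟨t, rfl⟩ := hs u
  exact hF' c ⟨t, h⟩

theorem Skol.fin (n : ℕ) : Skol L (Fin n → ℤ) := by
  induction n with
  | zero =>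
    intro S _ R hR
    exact ⟨fun _ => 0, DFun.constT _, fun c ⟨y, h⟩ => by rwa [Subsingleton.elim 0 y]⟩
  | succ n ih =>
    refine (Skol.int.prod ih).surj (g := fun p => Fin.cons p.1 p.2) (DFun.pi fun b => ?_) ?_
    · refine Fin.cases ?_ (fun i => ?_) b
      · exact DFun.id.fst
      · exact DFun.id.snd.eval i
    · intro v
      exact ⟨(v 0, Fin.tail v), Fin.cons_self_tail v⟩

theorem Skol.all : Skol L T := by
  obtain ⟨n, ⟨e⟩⟩ := Finite.exists_equiv_fin (Crd.ι T)
  refine (Skol.fin n).surj (g := fun v => Crd.e.symm (v ∘ e))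
    (DFun.ofCoord (fun i => e i) fun g i => ?_) ?_
  · simp; rfl
  · intro t
    exact ⟨Crd.e t ∘ e.symm, by simp [Function.comp_assoc]⟩

/-- sup-norm box -/
abbrev Box {β : Type} (y : β → ℤ) (k : ℤ) : Prop := ∀ b, |y b| ≤ k

theorem box_unif {β : Type} [Fintype β] (k : ℤ) {Q : (β → ℤ) → ℤ → Prop}
    (hQ : ∀ c N N', N ≤ N' → Q c N → Q c N') (h : ∀ c, Box c k → ∃ N, Q c N) :
    ∃ N, ∀ c, Box c k → Q c N := by
  classical
  choose! N hN using h
  refine ⟨∑ c ∈ Fintype.piFinset (fun _ : β => Finset.Icc (-k) k), |N c|, fun c hc => ?_⟩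
  refine hQ c (N c) _ ((le_abs_self _).trans ?_) (hN c hc)
  refine Finset.single_le_sum (f := fun c => |N c|) (fun b _ => abs_nonneg _) ?_
  simp only [Fintype.mem_piFinset, Finset.mem_Icc]
  exact fun b => abs_le.1 (hc b)

theorem Box.mono {β : Type} {y : β → ℤ} {k k' : ℤ} (h : Box y k) (hk : k ≤ k') : Box y k' :=
  fun b => (h b).trans hk

/-- `v` is a period of `X` in the box of size `k` around `y`. -/
abbrev LPer {β : Type} (X : (β → ℤ) → Prop) (v y : β → ℤ) (k : ℤ) : Prop :=
  ∀ u : β → ℤ, Box (u - y) k → Box (u + v - y) k → (X u ↔ X (u + v))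

theorem lemE {β : Type} [Fintype β] (H : Mnl L) {X : (β → ℤ) → Prop} (hX : Dfn L X) :
    ∃ s : ℤ, ∀ k : ℤ, ∃ t : ℤ, ∀ y, ¬ Box y t → ∃ v, v ≠ 0 ∧ Box v s ∧ LPer X v y k := by
  by_contra hcon
  push Not at hcon
  let Bad : ((ℤ × ℤ) × ℤ) × (β → ℤ) → Prop := fun p => ¬ (∀ b, |p.2 b| ≤ p.1.2) ∧
    ∀ v : β → ℤ, v ≠ 0 → (∀ b, |v b| ≤ p.1.1.1) → ¬ (∀ u : β → ℤ,
      (∀ b, |u b - p.2 b| ≤ p.1.1.2) → (∀ b, |u b + v b - p.2 b| ≤ p.1.1.2) → (X u ↔ X (u + v)))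
  have hBad : Dfn L Bad := dfn
  obtain ⟨Y, hY, hY'⟩ := Skol.all _ Bad hBad
  obtain ⟨D, hD, B, hB⟩ := lemCDv H hY
  obtain ⟨d, hd, hper⟩ := lemB H (P := fun p : ((ℤ × ℤ) × (β → ℤ)) × ℤ =>
    X (p.1.2 + Y (p.1.1, p.2))) dfn
  obtain ⟨k, hk⟩ := hcon (d * B)
  have hYB : ∀ t, Bad (((d * B, k), t), Y ((d * B, k), t)) := by
    intro t
    apply hY'
    obtain ⟨y, h1, h2⟩ := hk t
    refine ⟨y, by simpa using h1, fun v hv hvb hu => ?_⟩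
    exact h2 v hv hvb hu
  set y : ℤ → β → ℤ := fun t => Y ((d * B, k), t) with hy
  obtain ⟨w, hw, hsl⟩ := hB (d * B, k)
  have hB0 : ∀ b, 0 ≤ B := fun b => (abs_nonneg _).trans (hw b)
  have hw0 : w ≠ 0 := by
    rintro rfl
    obtain ⟨N, hN⟩ := hsl
    set t := D * (|N|) with ht
    have htN : N ≤ t := by have := abs_nonneg N; have := le_abs_self N; nlinarith
    obtain ⟨j, hj⟩ : ∃ j : ℕ, ∀ b, |y t b| ≤ j := by
      refine ⟨∑ b, (y t b).natAbs, fun b => ?_⟩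
      rw [Int.abs_eq_natAbs]
      exact_mod_cast Finset.single_le_sum (f := fun b => (y t b).natAbs)
        (fun _ _ => Nat.zero_le _) (Finset.mem_univ b)
    have hiN : ∀ j : ℕ, y (t + D * j) = y t := by
      intro j
      induction j with
      | zero => simp
      | succ j ih =>
        have h1 := hN (t + D * j) (by nlinarith) (dvd_add (Dvd.intro _ rfl) (Dvd.intro _ rfl))
        rw [show t + D * ((j + 1 : ℕ) : ℤ) = t + D * j + D by push_cast; ring]
        simp only [add_zero] at h1
        exact h1.trans ih
    refine (hYB (t + D * j)).1 fun b => ?_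
    have h1 := hj b
    have h2 := congrFun (hiN j) b
    simp only at h2 ⊢
    change |y (t + D * j) b| ≤ _
    rw [h2]
    have : 0 ≤ t := by positivity
    nlinarith
  set v : β → ℤ := d.toNat • w with hv
  have hdn : ((d.toNat : ℕ) : ℤ) = d := Int.toNat_of_nonneg (by omega)
  have hvb : ∀ b, v b = d * w b := fun b => by rw [hv, Pi.smul_apply, nsmul_eq_mul, hdn]
  have hv0 : v ≠ 0 := by
    intro h
    apply hw0
    ext b
    have := congrFun h b
    rw [hvb] at this
    simp at this
    rcases this with h | h
    · omega
    · simpa using h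
  have hvB : ∀ b, |v b| ≤ d * B := by
    intro b
    rw [hvb, abs_mul, abs_of_pos (by omega)]
    have := hw b
    nlinarith
  obtain ⟨N1, hN1⟩ := hsl.mul hD d.toNat
  rw [hdn] at hN1
  obtain ⟨N2, hN2⟩ := box_unif k (Q := fun u N => ∀ t, N ≤ t → (X (u + y t) ↔ X (u + y (t + d))))
    (fun c N N' h hQ t ht => hQ t (h.trans ht)) (fun u _ => hper ((d * B, k), u))
  set t := D * d * (|N1| + |N2|) with ht
  have a1 := abs_nonneg N1
  have a2 := abs_nonneg N2
  have a3 := le_abs_self N1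
  have a4 := le_abs_self N2
  have a5 : 1 ≤ D * d := by nlinarith
  have ht1 : N1 ≤ t := by nlinarith
  have ht2 : N2 ≤ t := by nlinarith
  have hyv : y (t + D * d) = y t + v := hN1 t ht1 (Dvd.intro _ rfl)
  have hit : ∀ u, Box u k → ∀ j : ℕ, (X (u + y t) ↔ X (u + y (t + d * j))) := by
    intro u hu j
    induction j with
    | zero => simp
    | succ j ih =>
      rw [ih, hN2 u hu (t + d * j) (by nlinarith)]
      rw [show t + d * ((j + 1 : ℕ) : ℤ) = t + d * j + d by push_cast; ring]
  refine (hYB t).2 v hv0 hvB fun u hu _ => ?_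
  have h1 := hit (u - y t) hu D.toNat
  rw [Int.toNat_of_nonneg (by omega), mul_comm d D, hyv] at h1
  rw [sub_add_cancel, show u - y t + (y t + v) = u + v by abel] at h1
  exact h1

theorem lemF {β : Type} [Fintype β] (H : Mnl L) {X : (β → ℤ) → Prop} (hX : Dfn L X) :
    ∃ s C : ℤ, 0 < C ∧ ∀ k, 1 ≤ k → ∀ y, ¬ Box y (C * k) →
      ∃ v, v ≠ 0 ∧ Box v s ∧ LPer X v y k := by
  obtain ⟨s, hs⟩ := lemE H hX
  obtain ⟨C, hC, hR⟩ := lemA H (R := fun p : ℤ × ℤ => ∃ y : β → ℤ, ¬ (∀ b, |y b| ≤ p.2) ∧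
    ∀ v : β → ℤ, v ≠ 0 → (∀ b, |v b| ≤ s) → ¬ (∀ u : β → ℤ,
      (∀ b, |u b - y b| ≤ p.1) → (∀ b, |u b + v b - y b| ≤ p.1) → (X u ↔ X (u + v)))) dfn (by
    intro k hk
    obtain ⟨t, ht⟩ := hs k
    refine ⟨t, ?_⟩
    rintro t' ⟨y, h1, h2⟩
    by_contra hlt
    obtain ⟨v, h3, h4, h5⟩ := ht y fun h => h1 (h.mono (by omega))
    exact h2 v h3 h4 h5)
  refine ⟨s, C + 1, by omega, fun k hk y hy => ?_⟩
  by_contra hcon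
  push Not at hcon
  have := hR k hk ((C + 1) * k) ⟨y, by simpa using hy, fun v h1 h2 h3 => hcon v h1 h2 h3⟩
  nlinarith

theorem lemO {β : Type} [Fintype β] (H : Mnl L) {X : (β → ℤ) × ℤ → Prop} (hX : Dfn L X) :
    ∃ d : ℤ, 1 ≤ d ∧ ∀ e : ℤ, 1 ≤ e → ∃ C : ℤ, 0 < C ∧ ∀ k, 1 ≤ k → ∀ c, Box c k → ∀ x,
      ¬ (X (c, x) ↔ X (c, x + d * e)) → |x| ≤ C * k := by
  obtain ⟨d1, hd1, h1⟩ := lemB H hX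
  obtain ⟨d2, hd2, h2⟩ := lemB H (P := fun p : (β → ℤ) × ℤ => X (p.1, - p.2)) dfn
  refine ⟨d1 * d2, by nlinarith, fun e he => ?_⟩
  have hmul : ∀ (P : ℤ → Prop) (d : ℤ) (n : ℕ), 1 ≤ d → (∃ N : ℤ, ∀ x, N ≤ x → (P x ↔ P (x + d))) →
      (∃ N : ℤ, ∀ x, N ≤ x → (P x ↔ P (x + d * n))) := by
    rintro P d n hd ⟨N, hN⟩
    refine ⟨N, fun x hx => ?_⟩
    induction n with
    | zero => simp
    | succ n ih =>
      rw [ih, hN (x + d * n) (by nlinarith)]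
      rw [show x + d * ((n + 1 : ℕ) : ℤ) = x + d * n + d by push_cast; ring]
  set d := d1 * d2 * e with hd
  have hd0 : 1 ≤ d := by
    have : 1 ≤ d1 * d2 := by nlinarith
    nlinarith
  have hup : ∀ c, ∃ N : ℤ, ∀ x, N ≤ x → (X (c, x) ↔ X (c, x + d)) := by
    intro c
    have := hmul (fun x => X (c, x)) d1 (d2 * e).toNat hd1 (h1 c)
    rwa [Int.toNat_of_nonneg (by positivity), ← mul_assoc] at this
  have hdn : ∀ c, ∃ N : ℤ, ∀ x, N ≤ x → (X (c, -x) ↔ X (c, -(x + d))) := by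
    intro c
    have := hmul (fun x => X (c, -x)) d2 (d1 * e).toNat hd2 (h2 c)
    rwa [Int.toNat_of_nonneg (by positivity), ← mul_assoc, mul_comm d2 d1] at this
  obtain ⟨C, hC, hR⟩ := lemA H (R := fun p : ℤ × ℤ => ∃ c : β → ℤ, (∀ b, |c b| ≤ p.1) ∧
    (¬ (X (c, p.2) ↔ X (c, p.2 + d)) ∨ ¬ (X (c, - p.2) ↔ X (c, - p.2 + d)))) dfn (by
    intro k hk
    obtain ⟨N, hN⟩ := box_unif (β := β) k (Q := fun c N => ∀ x, N ≤ x →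
        (X (c, x) ↔ X (c, x + d)) ∧ (X (c, -x) ↔ X (c, -x + d)))
      (fun c N N' h hQ t ht => hQ t (h.trans ht)) (fun c _ => by
        obtain ⟨N, hN⟩ := hup c
        obtain ⟨N', hN'⟩ := hdn c
        refine ⟨max N (N' + d), fun x hx => ⟨hN x (le_of_max_le_left hx), ?_⟩⟩
        have h1 := hN' (x - d) (by have := le_of_max_le_right hx; omega)
        rw [show -(x - d) = - x + d by ring, sub_add_cancel] at h1
        exact h1.symm)
    refine ⟨N, ?_⟩
    rintro y ⟨c, hc, hy⟩
    by_contra hlt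
    have := hN c hc y (by omega)
    tauto)
  refine ⟨C, hC, fun k hk c hc x hx => abs_le.2 ⟨?_, ?_⟩⟩
  · have := hR k hk (-x) ⟨c, hc, Or.inr (by simpa using hx)⟩
    omega
  · exact hR k hk x ⟨c, hc, Or.inl hx⟩

end Muchnik

section Counting
open FirstOrder.Language
variable {L : Language} [L.Structure ℤ] [Arith L]
variable {S T U : Type} [Crd S] [Crd T] [Crd U]

/-- at most `K` integers satisfy `P` -/
def AtMost (K : ℕ) (P : ℤ → Prop) : Prop := ∀ T : Finset ℤ, (∀ x ∈ T, P x) → T.card ≤ K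

theorem AtMost.mono {K K' : ℕ} {P Q : ℤ → Prop} (h : AtMost K Q) (hPQ : ∀ x, P x → Q x)
    (hK : K ≤ K') : AtMost K' P := fun T hT => (h T fun x hx => hPQ x (hT x hx)).trans hK

theorem AtMost.shift {K : ℕ} {P : ℤ → Prop} (h : AtMost K P) (a : ℤ) :
    AtMost K (fun x => P (x + a)) := by
  intro T hT
  have := h (T.map (addRightEmbedding a)) (by
    intro x hx
    simp only [Finset.mem_map, addRightEmbedding_apply] at hx
    obtain ⟨y, hy, rfl⟩ := hx
    exact hT y hy)
  simpa using this

theorem AtMost.cover {K n : ℕ} {P : ℤ → Prop} {Q : ℕ → ℤ → Prop}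
    (h : ∀ i < n, AtMost K (Q i)) (hP : ∀ x, P x → ∃ i < n, Q i x) : AtMost (n * K) P := by
  classical
  intro T hT
  have h1 : T ⊆ (Finset.range n).biUnion fun i => T.filter (Q i) := by
    intro x hx
    obtain ⟨i, hi, hq⟩ := hP x (hT x hx)
    simp only [Finset.mem_biUnion, Finset.mem_range, Finset.mem_filter]
    exact ⟨i, hi, hx, hq⟩
  refine (Finset.card_le_card h1).trans ?_
  have := Finset.card_biUnion_le_card_mul (Finset.range n) (fun i => T.filter (Q i)) K
    (fun i hi => h i (Finset.mem_range.1 hi) _ fun x hx => (Finset.mem_filter.1 hx).2)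
  simpa using this

theorem AtMost.bdd {P : ℤ → Prop} {B : ℤ} (h : ∀ x, P x → |x| ≤ B) :
    AtMost (2 * B + 1).toNat P := by
  intro T hT
  have h1 : T ⊆ Finset.Icc (-B) B := fun x hx => Finset.mem_Icc.2 (abs_le.1 (h x (hT x hx)))
  refine (Finset.card_le_card h1).trans ?_
  rw [Int.card_Icc]
  apply le_of_eq
  congr 1
  ring

/-- `x` is a `d`-break of `P` -/
abbrev Brk (P : ℤ → Prop) (d x : ℤ) : Prop := ¬ (P x ↔ P (x + d))

theorem brk_mul {P : ℤ → Prop} {d : ℤ} {n : ℕ} {x : ℤ} (h : Brk P (d * n) x) :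
    ∃ i < n, Brk P d (x + d * i) := by
  by_contra hcon
  push Not at hcon
  apply h
  clear h
  induction n with
  | zero => simp
  | succ n ih =>
    rw [ih fun i hi => hcon i (by omega), hcon n (by omega)]
    rw [show x + d * ((n + 1 : ℕ) : ℤ) = x + d * n + d by push_cast; ring]

/-- uniformly boundedly many `d`-breaks -/
def UB {S : Type} (X : S × ℤ → Prop) (d : ℤ) : Prop :=
  ∃ K : ℕ, ∀ c, AtMost K (Brk (fun x => X (c, x)) d)

theorem UB.mul {S : Type} {X : S × ℤ → Prop} {d : ℤ} (h : UB X d) (n : ℕ) : UB X (d * n) := by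
  obtain ⟨K, hK⟩ := h
  exact ⟨n * K, fun c => AtMost.cover (fun i _ => (hK c).shift (d * i)) fun x hx => brk_mul hx⟩

theorem UB.dvd {S : Type} {X : S × ℤ → Prop} {d e : ℤ} (h : UB X d) (hd : 1 ≤ d) (he : 1 ≤ e)
    (hde : d ∣ e) : UB X e := by
  obtain ⟨k, rfl⟩ := hde
  have : 0 ≤ k := by by_contra h; nlinarith
  lift k to ℕ using this
  exact h.mul k

theorem prod_one_le {ι : Type*} (s : Finset ι) (D : ι → ℤ) (hD : ∀ i ∈ s, 1 ≤ D i) :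
    1 ≤ ∏ b ∈ s, D b :=
  Int.add_one_le_iff.2 (Finset.prod_pos fun b hb => by linarith [hD b hb])

theorem lemCDp {β : Type} [Fintype β] (H : Mnl L) {f : S × ℤ → (β → ℤ) × ℤ} (hf : DFun L f) :
    ∃ D : ℤ, 1 ≤ D ∧ ∃ B : ℤ, ∀ c, ∃ w : (β → ℤ) × ℤ, Box w.1 B ∧ |w.2| ≤ B ∧
      Slope (fun x => f (c, x)) D w := by
  obtain ⟨D, hD, B, hB⟩ := lemCDv (β := Option β) H
    (f := fun p o => Option.elim o (f p).2 (f p).1) (DFun.pi fun o => by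
      cases o with
      | none => exact hf.snd
      | some b => exact hf.fst.eval b)
  refine ⟨D, hD, B, fun c => ?_⟩
  obtain ⟨w, hw, N, hN⟩ := hB c
  refine ⟨(fun b => w (some b), w none), fun b => hw _, hw _, N, fun x hx hx' => ?_⟩
  have h1 := hN x hx hx'
  refine Prod.ext (funext fun b => ?_) ?_
  · exact congrFun h1 (some b)
  · exact congrFun h1 none

theorem lemFp {β : Type} [Fintype β] (H : Mnl L) {X : (β → ℤ) × ℤ → Prop} (hX : Dfn L X) :
    ∃ s C : ℤ, 1 ≤ s ∧ 0 < C ∧ ∀ k, 1 ≤ k → ∀ c x, ¬ Box c (C * k) →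
      ∃ v : (β → ℤ) × ℤ, v ≠ 0 ∧ Box v.1 s ∧ |v.2| ≤ s ∧ ∀ u : (β → ℤ) × ℤ,
        Box (u.1 - c) k → |u.2 - x| ≤ k → Box (u.1 + v.1 - c) k → |u.2 + v.2 - x| ≤ k →
          (X u ↔ X (u + v)) := by
  have hd : Dfn L (fun u : Option β → ℤ => X (fun b => u (some b), u none)) := dfn
  obtain ⟨s, C, hC, h⟩ := lemF H hd
  refine ⟨max s 1, C, le_max_right _ _, hC, fun k hk c x hc => ?_⟩
  obtain ⟨v, h1, h2, h3⟩ := h k hk (fun o => Option.elim o x c) (fun hb => hc fun b => hb (some b))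
  refine ⟨(fun b => v (some b), v none), ?_, fun b => (h2 _).trans (le_max_left _ _),
    (h2 _).trans (le_max_left _ _), ?_⟩
  · intro h0
    apply h1
    funext o
    cases o with
    | none => exact congrArg Prod.snd h0
    | some b => exact congrFun (congrArg Prod.fst h0) b
  · intro u a1 a2 a3 a4
    exact h3 (fun o => Option.elim o u.2 u.1) (fun o => by
      cases o with
      | none => exact a2
      | some b => exact a1 b) (fun o => by
      cases o with
      | none => exact a4
      | some b => exact a3 b)

/-- `L`-windows with equal patterns -/
abbrev Same {β : Type} (X : (β → ℤ) × ℤ → Prop) (p q : (β → ℤ) × ℤ) (l : ℤ) : Prop :=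
  ∀ y, 0 ≤ y → y ≤ l → (X (p.1, p.2 + y) ↔ X (q.1, q.2 + y))

theorem chain {P : ℤ → Prop} {v l : ℤ} (hv : 0 ≤ v) (h : ∀ y, 0 ≤ y → y + v ≤ l → (P y ↔ P (y + v)))
    (n : ℕ) : ∀ y, 0 ≤ y → y + v * n ≤ l → (P y ↔ P (y + v * n)) := by
  induction n with
  | zero => simp
  | succ n ih =>
    intro y hy hyl
    push_cast at hyl ⊢
    rw [ih y hy (by nlinarith), h (y + v * n) (by positivity) (by linarith)]
    rw [show y + v * (n + 1) = y + v * n + v by ring]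

theorem recur1 {β : Type} [Fintype β] {X : (β → ℤ) × ℤ → Prop} {s C d0 : ℤ} (hs : 1 ≤ s)
    (hC : 0 < C)
    (hF : ∀ k, 1 ≤ k → ∀ c x, ¬ Box c (C * k) →
      ∃ v : (β → ℤ) × ℤ, v ≠ 0 ∧ Box v.1 s ∧ |v.2| ≤ s ∧ ∀ u : (β → ℤ) × ℤ,
        Box (u.1 - c) k → |u.2 - x| ≤ k → Box (u.1 + v.1 - c) k → |u.2 + v.2 - x| ≤ k →
          (X u ↔ X (u + v)))
    (hd0 : 1 ≤ d0) (hdvd : ∀ i, 1 ≤ i → i ≤ s → i ∣ d0) {c : β → ℤ} {x l : ℤ} (hl : 0 ≤ l)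
    (hc : Fintype.card β * (C * (l + s)) ^ 2 < ∑ b, c b ^ 2)
    (hbr : ∃ y, 0 ≤ y ∧ y + d0 ≤ l ∧ Brk (fun y => X (c, x + y)) d0 y) :
    ∃ q : (β → ℤ) × ℤ, ∑ b, c b ^ 2 + 1 ≤ ∑ b, q.1 b ^ 2 ∧ Same X (c, x) q l := by
  have hnb : ¬ Box c (C * (l + s)) := by
    intro hb
    refine absurd hc (not_lt.2 ?_)
    have : ∑ b : β, c b ^ 2 ≤ ∑ b : β, (C * (l + s)) ^ 2 :=
      Finset.sum_le_sum fun b _ => sq_le_sq' (abs_le.1 (hb b)).1 (abs_le.1 (hb b)).2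
    simpa using this
  obtain ⟨v, hv0, hv1, hv2, hv⟩ := hF (l + s) (by omega) c x hnb
  have hv2' := abs_le.1 hv2
  have hfw : Same X (c, x) (c + v.1, x + v.2) l := by
    intro y hy hyl
    have := hv (c, x + y) (fun b => by simp; omega) (by simp; rw [abs_of_nonneg hy]; omega)
      (fun b => by simpa using (hv1 b).trans (by omega)) (by
        rw [abs_le]; constructor <;> simp only <;> omega)
    rw [this]
    simp only [show (c, x + y) + v = (c + v.1, x + y + v.2) from rfl]
    rw [show x + v.2 + y = x + y + v.2 by ring]
  have hbw : Same X (c, x) (c - v.1, x - v.2) l := by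
    intro y hy hyl
    have := hv (c - v.1, x - v.2 + y) (fun b => by simpa using (hv1 b).trans (by omega)) (by
        rw [abs_le]; constructor <;> simp only <;> omega) (fun b => by simp; omega) (by
        simp only; rw [abs_le]; constructor <;> omega)
    rw [this]
    rw [show (c - v.1, x - v.2 + y) + v = (c - v.1 + v.1, x - v.2 + y + v.2) from rfl]
    rw [sub_add_cancel, show x - v.2 + y + v.2 = x + y by ring]
  by_cases hz : v.1 = 0
  · exfalso
    obtain ⟨y, hy, hyl, hb⟩ := hbr
    apply hb
    have hv20 : v.2 ≠ 0 := fun h => hv0 (Prod.ext hz h)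
    have key : ∀ y, 0 ≤ y → y + |v.2| ≤ l → (X (c, x + y) ↔ X (c, x + (y + |v.2|))) := by
      intro y hy hyl
      rcases abs_cases v.2 with ⟨h, h'⟩ | ⟨h, h'⟩
      · rw [h] at hyl ⊢
        have := hfw y hy (by omega)
        simp only [hz, add_zero] at this
        rw [this, show x + (y + v.2) = x + v.2 + y by ring]
      · rw [h] at hyl ⊢
        have := hbw y hy (by omega)
        simp only [hz, sub_zero] at this
        rw [this, show x + (y + -v.2) = x - v.2 + y by ring]
    obtain ⟨n, hn⟩ := hdvd |v.2| (by have := abs_pos.2 hv20; omega) hv2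
    have hpos := abs_pos.2 hv20
    have : 0 ≤ n := by by_contra h; nlinarith
    lift n to ℕ using this
    have := chain (P := fun y => X (c, x + y)) (abs_nonneg v.2) key n y hy (by rw [← hn]; exact hyl)
    rw [← hn] at this
    exact this
  · have hpos : 1 ≤ ∑ b, v.1 b ^ 2 := by
      obtain ⟨b, hb⟩ : ∃ b, v.1 b ≠ 0 := by
        by_contra h; push Not at h; exact hz (funext h)
      have h1 : 0 < v.1 b ^ 2 := by positivity
      have h2 := Finset.single_le_sum (f := fun b => v.1 b ^ 2) (fun b _ => sq_nonneg _)
        (Finset.mem_univ b)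
      omega
    by_cases hsg : 0 ≤ ∑ b, c b * v.1 b
    · refine ⟨(c + v.1, x + v.2), ?_, hfw⟩
      have : ∑ b, (c + v.1) b ^ 2 = ∑ b, c b ^ 2 + 2 * ∑ b, c b * v.1 b + ∑ b, v.1 b ^ 2 := by
        rw [Finset.mul_sum, ← Finset.sum_add_distrib, ← Finset.sum_add_distrib]
        exact Finset.sum_congr rfl fun b _ => by simp; ring
      simp only [this]
      linarith
    · refine ⟨(c - v.1, x - v.2), ?_, hbw⟩
      have : ∑ b, (c - v.1) b ^ 2 = ∑ b, c b ^ 2 - 2 * ∑ b, c b * v.1 b + ∑ b, v.1 b ^ 2 := by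
        rw [Finset.mul_sum, ← Finset.sum_sub_distrib, ← Finset.sum_add_distrib]
        exact Finset.sum_congr rfl fun b _ => by simp; ring
      simp only [this]
      linarith

theorem recur {β : Type} [Fintype β] {X : (β → ℤ) × ℤ → Prop} {s C d0 : ℤ} (hs : 1 ≤ s)
    (hC : 0 < C)
    (hF : ∀ k, 1 ≤ k → ∀ c x, ¬ Box c (C * k) →
      ∃ v : (β → ℤ) × ℤ, v ≠ 0 ∧ Box v.1 s ∧ |v.2| ≤ s ∧ ∀ u : (β → ℤ) × ℤ,
        Box (u.1 - c) k → |u.2 - x| ≤ k → Box (u.1 + v.1 - c) k → |u.2 + v.2 - x| ≤ k →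
          (X u ↔ X (u + v)))
    (hd0 : 1 ≤ d0) (hdvd : ∀ i, 1 ≤ i → i ≤ s → i ∣ d0) {c : β → ℤ} {x l : ℤ} (hl : 0 ≤ l)
    (hc : Fintype.card β * (C * (l + s)) ^ 2 < ∑ b, c b ^ 2)
    (hbr : ∃ y, 0 ≤ y ∧ y + d0 ≤ l ∧ Brk (fun y => X (c, x + y)) d0 y) (t : ℤ) :
    ∃ q : (β → ℤ) × ℤ, ¬ Box q.1 t ∧ Same X (c, x) q l := by
  have key : ∀ n : ℕ, ∃ q : (β → ℤ) × ℤ, ∑ b, c b ^ 2 + n ≤ ∑ b, q.1 b ^ 2 ∧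
      Same X (c, x) q l := by
    intro n
    induction n with
    | zero => exact ⟨(c, x), by simp, fun y _ _ => Iff.rfl⟩
    | succ n ih =>
      obtain ⟨q, hq, hS⟩ := ih
      obtain ⟨q', hq', hS'⟩ := recur1 hs hC hF hd0 hdvd (c := q.1) (x := q.2) hl (by omega) (by
        obtain ⟨y, h1, h2, h3⟩ := hbr
        refine ⟨y, h1, h2, ?_⟩
        have a1 := hS y h1 (by omega)
        have a2 := hS (y + d0) (by omega) h2
        simp only [Brk] at h3 ⊢ a1 a2
        rw [← a1, ← a2]
        exact h3)
      exact ⟨q', by push_cast; omega, fun y h1 h2 => (hS y h1 h2).trans (hS' y h1 h2)⟩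
  obtain ⟨q, hq, hS⟩ := key (Fintype.card β * t ^ 2 + 1).toNat
  refine ⟨q, fun hb => ?_, hS⟩
  rw [Int.toNat_of_nonneg (by positivity)] at hq
  have h1 : ∑ b : β, q.1 b ^ 2 ≤ ∑ b : β, t ^ 2 :=
    Finset.sum_le_sum fun b _ => sq_le_sq' (abs_le.1 (hb b)).1 (abs_le.1 (hb b)).2
  have h2 : 0 ≤ ∑ b, c b ^ 2 := Finset.sum_nonneg fun b _ => sq_nonneg _
  simp at h1
  linarith

theorem invar {β : Type} {Y : (β → ℤ) × ℤ → Prop} {v : (β → ℤ) × ℤ}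
    (hY : ∀ u, Y (u + v) ↔ Y u) (q : ℤ) : ∀ u, Y (u + q • v) ↔ Y u := by
  induction q using Int.induction_on with
  | zero => simp
  | succ i ih =>
    intro u
    rw [add_zsmul, one_zsmul, ← add_assoc, hY, ih]
  | pred i ih =>
    intro u
    rw [sub_zsmul, one_zsmul, ← hY, show u + (-(i : ℤ) • v + -v) + v = u + -(i : ℤ) • v by abel, ih]

theorem lemR {n : ℕ}
    (hU : ∀ X : (Fin n → ℤ) × ℤ → Prop, Dfn L X → ∃ d, 1 ≤ d ∧ UB X d)
    {Y : (Fin (n + 1) → ℤ) × ℤ → Prop} (hdY : Dfn L Y) {v : (Fin (n + 1) → ℤ) × ℤ}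
    (hY : ∀ u, Y (u + v) ↔ Y u) (r : Fin (n + 1)) (hr : v.1 r ≠ 0) : ∃ d, 1 ≤ d ∧ UB Y d := by
  have h1 : ∀ z : ℤ, Dfn L (fun p : (Fin n → ℤ) × ℤ =>
      Y (r.insertNth (α := fun _ => ℤ) z p.1, p.2)) := by
    intro z
    refine hdY.comp (DFun.pair (DFun.pi fun b => ?_) DFun.id.snd)
    rcases Fin.eq_self_or_eq_succAbove r b with rfl | ⟨j, rfl⟩
    · simpa using DFun.constT z
    · simpa using DFun.id.fst.eval j
  choose d hd hub using fun z => hU _ (h1 z)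
  have hdz : 1 ≤ ∏ z ∈ Finset.Ico 0 |v.1 r|, d z := prod_one_le _ _ fun z _ => hd z
  refine ⟨∏ z ∈ Finset.Ico 0 |v.1 r|, d z, hdz, ?_⟩
  choose! K hK using fun z (hz : z ∈ Finset.Ico 0 |v.1 r|) =>
    (hub z).dvd (hd z) hdz (Finset.dvd_prod_of_mem d hz)
  refine ⟨∑ z ∈ Finset.Ico 0 |v.1 r|, K z, fun c => ?_⟩
  set q := c r / v.1 r
  set z := c r % v.1 r with hzdef
  have hz : z ∈ Finset.Ico 0 |v.1 r| :=
    Finset.mem_Ico.2 ⟨Int.emod_nonneg _ hr, Int.emod_lt_abs _ hr⟩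
  have h2 := (hK z hz (r.removeNth (c - q • v.1))).shift (-(q * v.2))
  have hins : r.insertNth (α := fun _ => ℤ) z (r.removeNth (c - q • v.1)) = c - q • v.1 := by
    have : z = (c - q • v.1) r := by
      simp only [Pi.sub_apply, Pi.smul_apply, smul_eq_mul, hzdef, Int.emod_def]
      ring
    rw [this, Fin.insertNth_self_removeNth]
  have h3 : ∀ x, Y (c, x) ↔ Y (c - q • v.1, x + -(q * v.2)) := by
    intro x
    rw [← invar hY q (c - q • v.1, x + -(q * v.2))]
    have : (c - q • v.1, x + -(q * v.2)) + q • v = (c, x) := by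
      refine Prod.ext ?_ ?_
      · change c - q • v.1 + q • v.1 = c
        abel
      · change x + -(q * v.2) + q • v.2 = x
        simp
    rw [this]
  refine h2.mono (fun x hx => ?_) (Finset.single_le_sum (f := K) (fun _ _ => Nat.zero_le _) hz)
  simp only [Brk, hins] at hx ⊢
  rw [h3, h3 (x + _)] at hx
  convert hx using 4
  ring_nf

end Counting

section Uniform
open FirstOrder.Language
variable {L : Language} [L.Structure ℤ] [Arith L]
variable {S T U : Type} [Crd S] [Crd T] [Crd U]

theorem escape {β : Type} [Fintype β] {y : ℤ → β → ℤ} {D : ℤ} (hD : 1 ≤ D)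
    (hsl : Slope y D 0) (hy : ∀ t, ¬ Box (y t) t) : False := by
  obtain ⟨N, hN⟩ := hsl
  set t := D * (|N|) with ht
  have htN : N ≤ t := by have := abs_nonneg N; have := le_abs_self N; nlinarith
  obtain ⟨j, hj⟩ : ∃ j : ℕ, ∀ b, |y t b| ≤ j := by
    refine ⟨∑ b, (y t b).natAbs, fun b => ?_⟩
    rw [Int.abs_eq_natAbs]
    exact_mod_cast Finset.single_le_sum (f := fun b => (y t b).natAbs)
      (fun _ _ => Nat.zero_le _) (Finset.mem_univ b)
  have hiN : ∀ j : ℕ, y (t + D * j) = y t := by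
    intro j
    induction j with
    | zero => simp
    | succ j ih =>
      have h1 := hN (t + D * j) (by nlinarith) (dvd_add (Dvd.intro _ rfl) (Dvd.intro _ rfl))
      rw [show t + D * ((j + 1 : ℕ) : ℤ) = t + D * j + D by push_cast; ring]
      simp only [add_zero] at h1
      exact h1.trans ih
  refine hy (t + D * j) fun b => ?_
  rw [congrFun (hiN j) b]
  have : 0 ≤ t := by positivity
  have := hj b
  nlinarith

/-- limits along a direction -/
theorem dirlim (H : Mnl L) {β : Type} [Fintype β] {X : (β → ℤ) × ℤ → Prop} (hX : Dfn L X)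
    (w : (β → ℤ) × ℤ) : ∃ e : ℕ, 1 ≤ e ∧ ∃ Z : (β → ℤ) × ℤ → Prop, Dfn L Z ∧
      (∀ u, Z (u + (e : ℤ) • w) ↔ Z u) ∧
      ∀ u, ∀ p : Prop, (∀ j : ℕ, X (u + (j : ℤ) • w) ↔ p) → (Z u ↔ p) := by
  have hP : Dfn L (fun q : ((β → ℤ) × ℤ) × ℤ =>
      X (fun b => q.1.1 b + w.1 b * q.2, q.1.2 + w.2 * q.2)) := dfn
  obtain ⟨e, he, hper⟩ := lemB H hP
  lift e to ℕ using by omega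
  refine ⟨e, by omega, fun u => ∃ N : ℤ, ∀ j, N ≤ j → (e : ℤ) ∣ j →
    X (fun b => u.1 b + w.1 b * j, u.2 + w.2 * j), dfn, ?_, ?_⟩
  · have key : ∀ (u : (β → ℤ) × ℤ) (j : ℤ), X (fun b => (u + (e : ℤ) • w).1 b + w.1 b * j,
      (u + (e : ℤ) • w).2 + w.2 * j) ↔ X (fun b => u.1 b + w.1 b * (j + e), u.2 + w.2 * (j + e)) := by
      intro u j
      have : ∀ a b : (β → ℤ) × ℤ, a = b → (X a ↔ X b) := by rintro a _ rfl; rfl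
      apply this
      refine Prod.ext (funext fun b => ?_) ?_
      · simp; ring
      · simp; ring
    intro u
    simp only [key]
    constructor
    · rintro ⟨N, hN⟩
      refine ⟨N + e, fun j hj hej => ?_⟩
      have := hN (j - e) (by omega) (dvd_sub_self_right.2 hej)
      simpa using this
    · rintro ⟨N, hN⟩
      exact ⟨N - e, fun j hj hej => hN (j + e) (by omega) (dvd_add_self_right.2 hej)⟩
  · intro u p hp
    have key : ∀ j : ℕ, X (fun b => u.1 b + w.1 b * (j : ℤ), u.2 + w.2 * (j : ℤ)) ↔ p := by
      intro j
      rw [← hp j]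
      have : ∀ a b : (β → ℤ) × ℤ, a = b → (X a ↔ X b) := by rintro a _ rfl; rfl
      apply this
      refine Prod.ext (funext fun b => ?_) ?_
      · simp; ring
      · simp; ring
    constructor
    · rintro ⟨N, hN⟩
      have := hN ((e * N.toNat : ℕ) : ℤ) (by
        push_cast
        have := Int.self_le_toNat N
        nlinarith) (by simp)
      exact (key _).1 this
    · intro h
      refine ⟨0, fun j hj _ => ?_⟩
      lift j to ℕ using hj
      exact (key j).2 h

theorem window (H : Mnl L) {n : ℕ}
    (hU : ∀ X : (Fin n → ℤ) × ℤ → Prop, Dfn L X → ∃ d, 1 ≤ d ∧ UB X d)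
    {X : (Fin (n + 1) → ℤ) × ℤ → Prop} (hX : Dfn L X) :
    ∃ d : ℤ, 1 ≤ d ∧ ∃ s A : ℤ, 1 ≤ s ∧ 0 < A ∧ ∀ e : ℤ, 1 ≤ e → ∃ K : ℕ,
      ∀ c x l, 0 ≤ l → ¬ Box c (A * (l + s)) →
        AtMost K (fun y => 0 ≤ y ∧ y + d * e ≤ l ∧ Brk (fun y => X (c, x + y)) (d * e) y) := by
  obtain ⟨s, C, hs, hC, hF⟩ := lemFp H hX
  have hd0 : (1 : ℤ) ≤ (s.toNat.factorial : ℤ) := by exact_mod_cast Nat.factorial_pos _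
  have hdvd : ∀ i : ℤ, 1 ≤ i → i ≤ s → i ∣ (s.toNat.factorial : ℤ) := by
    intro i h1 h2
    lift i to ℕ using by omega
    exact_mod_cast Nat.dvd_factorial (by omega) (by omega)
  set d0 : ℤ := (s.toNat.factorial : ℤ)
  let R : (((Fin (n + 1) → ℤ) × ℤ × ℤ) × ℤ) × ((Fin (n + 1) → ℤ) × ℤ) → Prop := fun p =>
    ¬ (∀ b, |p.2.1 b| ≤ p.1.2) ∧ ∀ y, 0 ≤ y → y ≤ p.1.1.2.2 →
      (X (p.1.1.1, p.1.1.2.1 + y) ↔ X (p.2.1, p.2.2 + y))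
  have hR : Dfn L R := dfn
  obtain ⟨F, hF1, hF2⟩ := Skol.all _ R hR
  obtain ⟨D, hD, B, hB⟩ := lemCDp H hF1
  choose e he Z hZ hZinv hZlim using dirlim H hX
  have hUw : ∀ w : (Fin (n + 1) → ℤ) × ℤ, ∃ d, 1 ≤ d ∧ (w.1 ≠ 0 → UB (Z w) d) := by
    intro w
    by_cases hw : w.1 = 0
    · exact ⟨1, le_rfl, fun h => absurd hw h⟩
    · obtain ⟨r, hr⟩ : ∃ b, w.1 b ≠ 0 := by
        by_contra h; push Not at h; exact hw (funext h)
      obtain ⟨d, h1, h2⟩ := lemR hU (hZ w) (v := (e w : ℤ) • w) (hZinv w) r (by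
        have := he w
        simp only [Prod.smul_fst, Pi.smul_apply, smul_eq_mul, ne_eq, mul_eq_zero, not_or]
        exact ⟨by omega, hr⟩)
      exact ⟨d, h1, fun _ => h2⟩
  choose dw hdw hUw using hUw
  let W : Finset ((Fin (n + 1) → ℤ) × ℤ) :=
    (Fintype.piFinset fun _ => Finset.Icc (-B) B) ×ˢ (Finset.Icc (-B) B)
  have hprod : 1 ≤ ∏ w ∈ W, dw w := prod_one_le _ _ fun w _ => hdw w
  refine ⟨d0 * ∏ w ∈ W, dw w, by nlinarith, s, (n + 1) * C, hs, by positivity, fun ε hε => ?_⟩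
  set d := d0 * (∏ w ∈ W, dw w) * ε with hd
  have hd1 : 1 ≤ d := by
    have : 1 ≤ d0 * (∏ w ∈ W, dw w) := by nlinarith
    nlinarith
  have hK : ∀ w, ∃ K : ℕ, w ∈ W → w.1 ≠ 0 → ∀ c, AtMost K (Brk (fun x => Z w (c, x)) d) := by
    intro w
    by_cases h : w ∈ W ∧ w.1 ≠ 0
    · obtain ⟨K, hK⟩ := (hUw w h.2).dvd (hdw w) hd1
        (((Finset.dvd_prod_of_mem dw h.1).trans (Dvd.intro_left d0 rfl)).trans (Dvd.intro ε rfl))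
      exact ⟨K, fun _ _ => hK⟩
    · exact ⟨0, fun h1 h2 => absurd ⟨h1, h2⟩ h⟩
  choose K hK using hK
  refine ⟨∑ w ∈ W, K w, fun c x l hl hc => ?_⟩
  have hE : Fintype.card (Fin (n + 1)) * (C * (l + s)) ^ 2 < ∑ b, c b ^ 2 := by
    simp only [not_forall, not_le] at hc
    obtain ⟨b, hb⟩ := hc
    have h1 := Finset.single_le_sum (f := fun b => c b ^ 2) (fun b _ => sq_nonneg _)
      (Finset.mem_univ b)
    refine lt_of_lt_of_le ?_ h1
    beta_reduce
    rw [← sq_abs (c b)]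
    have h2 : 0 ≤ C * (l + s) := by positivity
    have h3 : ((n : ℤ) + 1) * (C * (l + s)) < |c b| := by linarith
    have h4 : 0 ≤ ((n : ℤ) + 1) * (C * (l + s)) := by positivity
    have h5 : (((n : ℤ) + 1) * (C * (l + s))) ^ 2 < |c b| ^ 2 := by
      exact pow_lt_pow_left₀ h3 h4 (by norm_num)
    refine lt_of_le_of_lt ?_ h5
    simp only [Fintype.card_fin, Nat.cast_add, Nat.cast_one]
    rw [mul_pow]
    have : (0 : ℤ) ≤ n := by positivity
    have h6 := sq_nonneg (C * (l + s))
    nlinarith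
  by_cases hbr : ∃ y, 0 ≤ y ∧ y + d0 ≤ l ∧ Brk (fun y => X (c, x + y)) d0 y
  · have hrec : ∀ t, R (((c, x, l), t), F ((c, x, l), t)) := by
      intro t
      apply hF2
      obtain ⟨q, h1, h2⟩ := recur hs hC hF hd0 hdvd hl hE hbr t
      exact ⟨q, h1, h2⟩
    obtain ⟨w, hw1, hw2, hsl⟩ := hB (c, x, l)
    have hw0 : w.1 ≠ 0 := by
      intro h0
      refine escape (y := fun t => (F ((c, x, l), t)).1) hD ?_ (fun t => (hrec t).1)
      obtain ⟨N, hN⟩ := hsl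
      refine ⟨N, fun x hx hx' => ?_⟩
      have := congrArg Prod.fst (hN x hx hx')
      simp only [Prod.fst_add, h0] at this
      exact this
    have hwW : w ∈ W := by
      simp only [W, Finset.mem_product, Fintype.mem_piFinset, Finset.mem_Icc]
      exact ⟨fun b => abs_le.1 (hw1 b), abs_le.1 hw2⟩
    obtain ⟨t, ht⟩ : ∃ t, ∀ j : ℕ, F ((c, x, l), t + D * j) = F ((c, x, l), t) + (j : ℤ) • w := by
      obtain ⟨N, hN⟩ := hsl
      set t := D * (|N|) with ht
      have htN : N ≤ t := by have := abs_nonneg N; have := le_abs_self N; nlinarith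
      refine ⟨t, fun j => ?_⟩
      induction j with
      | zero => simp
      | succ j ih =>
        have h1 := hN (t + D * j) (by nlinarith) (dvd_add (Dvd.intro _ rfl) (Dvd.intro _ rfl))
        rw [show t + D * ((j + 1 : ℕ) : ℤ) = t + D * j + D by push_cast; ring]
        refine h1.trans ?_
        beta_reduce
        rw [ih]
        push_cast
        rw [add_zsmul, one_zsmul, add_assoc]
    set u := F ((c, x, l), t) with hu
    have hpat : ∀ y, 0 ≤ y → y ≤ l → (Z w (u.1, u.2 + y) ↔ X (c, x + y)) := by
      intro y hy hyl
      apply hZlim w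
      intro j
      have h1 := (hrec (t + D * j)).2 y hy hyl
      simp only [ht j] at h1
      rw [h1]
      have : ∀ a b : (Fin (n + 1) → ℤ) × ℤ, a = b → (X a ↔ X b) := by rintro a _ rfl; rfl
      apply this
      refine Prod.ext rfl ?_
      simp; ring
    refine ((hK w hwW hw0 u.1).shift u.2).mono (fun y hy => ?_)
      (Finset.single_le_sum (f := K) (fun _ _ => Nat.zero_le _) hwW)
    obtain ⟨h1, h2, h3⟩ := hy
    have a1 := hpat y h1 (by omega)
    have a2 := hpat (y + d) (by omega) h2
    simp only [Brk] at h3 ⊢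
    rw [← a1, ← a2] at h3
    rwa [add_comm y u.2, add_assoc]
  · push Not at hbr
    refine AtMost.mono (K := 0) (Q := fun _ => False) ?_ (fun y hy => ?_) (Nat.zero_le _)
    · intro T hT
      rw [Finset.eq_empty_of_forall_notMem hT]
      simp
    · obtain ⟨h1, h2, h3⟩ := hy
      apply h3
      have h0 : 0 ≤ (∏ w ∈ W, dw w) * ε := by positivity
      have := chain (P := fun y => X (c, x + y)) (by omega : 0 ≤ d0)
        (fun y hy hyl => hbr y hy hyl) ((∏ w ∈ W, dw w) * ε).toNat y h1
      rw [Int.toNat_of_nonneg h0, ← mul_assoc] at this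
      exact this h2

theorem lemU (H : Mnl L) (n : ℕ) :
    ∀ X : (Fin n → ℤ) × ℤ → Prop, Dfn L X → ∃ d, 1 ≤ d ∧ UB X d := by
  induction n with
  | zero =>
    intro X hX
    obtain ⟨d, hd, h⟩ := lemO H hX
    obtain ⟨C, hC, h⟩ := h 1 le_rfl
    rw [mul_one] at h
    exact ⟨d, hd, _, fun c => AtMost.bdd (B := C * 1) fun x hx => h 1 le_rfl c (fun b => b.elim0) x hx⟩
  | succ n ih =>
    intro X hX
    obtain ⟨d1, hd1, s, a, hs, ha, hwin⟩ := window H ih hX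
    obtain ⟨d2, hd2, hout⟩ := lemO H hX
    obtain ⟨K, hK⟩ := hwin d2 hd2
    obtain ⟨C, hC, hO⟩ := hout d1 hd1
    rw [mul_comm d2 d1] at hO
    have hd0 : 1 ≤ d1 * d2 := by nlinarith
    set d := d1 * d2 with hd
    refine ⟨d, hd0, (16 * a * C + 1).toNat * K + (2 * (C * (4 * a * (s + d + 1))) + 1).toNat,
      fun c => ?_⟩
    by_cases hsm : Box c (4 * a * (s + d + 1))
    · refine (AtMost.bdd (B := C * (4 * a * (s + d + 1))) fun x hx => ?_).mono (fun x hx => hx)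
        (Nat.le_add_left _ _)
      exact hO _ (by nlinarith) c hsm x hx
    · obtain ⟨b0, hb0⟩ := Finite.exists_max (fun b => |c b|)
      set k := |c b0| with hk
      have hk1 : 4 * a * (s + d + 1) < k := by
        by_contra h
        exact hsm fun b => (hb0 b).trans (not_lt.1 h)
      set q := k / (4 * a) with hq
      have h4a : 0 < 4 * a := by linarith
      have q1 : 4 * a * q ≤ k := Int.mul_ediv_self_le (by omega)
      have q2 : k < 4 * a * (q + 1) := by
        have := Int.lt_ediv_add_one_mul_self k h4a
        linarith
      have q3 : s + d + 1 ≤ q := by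
        by_contra h
        have : q + 1 ≤ s + d + 1 := by omega
        nlinarith
      have hQ : (((16 * a * C + 1).toNat : ℕ) : ℤ) = 16 * a * C + 1 :=
        Int.toNat_of_nonneg (by positivity)
      refine (AtMost.cover (K := K) (n := (16 * a * C + 1).toNat)
        (Q := fun i x => (0 ≤ (x - (-(C * k) + q * i)) ∧ (x - (-(C * k) + q * i)) + d ≤ 2 * q ∧
          Brk (fun y => X (c, (-(C * k) + q * i) + y)) d (x - (-(C * k) + q * i))))
        (fun i _ => ?_) fun x hx => ?_).mono (fun x hx => hx) (Nat.le_add_right _ _)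
      · refine (hK c (-(C * k) + q * i) (2 * q) (by omega) ?_).shift (-(-(C * k) + q * i))
        intro hb
        have h1 : k ≤ a * (2 * q + s) := hb b0
        nlinarith
      · have hx1 := abs_le.1 (hO k (by nlinarith) c hb0 x hx)
        have hi0 : 0 ≤ (x + C * k) / q := Int.ediv_nonneg (by linarith) (by omega)
        have i1 : q * ((x + C * k) / q) ≤ x + C * k := Int.mul_ediv_self_le (by omega)
        have i2 : x + C * k < q * ((x + C * k) / q + 1) := by
          have := Int.lt_ediv_add_one_mul_self (x + C * k) (show 0 < q by omega)
          linarith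
        refine ⟨((x + C * k) / q).toNat, ?_, ?_⟩
        · zify
          rw [hQ, Int.toNat_of_nonneg hi0]
          by_contra hge
          push Not at hge
          have h1 : q * (16 * a * C + 1) ≤ x + C * k :=
            (mul_le_mul_of_nonneg_left hge (by omega)).trans i1
          have h2 : k < 8 * a * q := by nlinarith
          have h3 : C * k < C * (8 * a * q) := mul_lt_mul_of_pos_left h2 hC
          nlinarith
        · rw [Int.toNat_of_nonneg hi0]
          refine ⟨by linarith, by linarith, ?_⟩
          simp only [Brk]
          rw [← add_assoc, add_sub_cancel]
          exact hx

end Uniform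

section Exchange
open FirstOrder.Language
variable {L : Language} [L.Structure ℤ] [Arith L]
variable {S T U : Type} [Crd S] [Crd T] [Crd U]

theorem lemUT (H : Mnl L) {X : S × ℤ → Prop} (hX : Dfn L X) : ∃ d, 1 ≤ d ∧ UB X d := by
  obtain ⟨n, ⟨e⟩⟩ := Finite.exists_equiv_fin (Crd.ι S)
  have hg : DFun L (fun v : Fin n → ℤ => (Crd.e.symm (v ∘ e) : S)) :=
    DFun.ofCoord (fun i => e i) fun g i => by simp; rfl
  obtain ⟨d, hd, K, hK⟩ := lemU H n (fun p => X (Crd.e.symm (p.1 ∘ e), p.2))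
    (hX.comp ((hg.comp DFun.id.fst).pair DFun.id.snd))
  refine ⟨d, hd, K, fun c => ?_⟩
  have := hK (Crd.e c ∘ e.symm)
  simpa [Function.comp_assoc] using this

theorem atMost_iff {K : ℕ} {P : ℤ → Prop} : AtMost K P ↔
    ¬ ∃ v : Fin (K + 1) → ℤ, (∀ j k, j ≠ k → v j ≠ v k) ∧ ∀ j, P (v j) := by
  constructor
  · rintro h ⟨v, hv, hP⟩
    have hinj : Function.Injective v := fun j k hjk => by
      by_contra hne; exact hv j k hne hjk
    have := h (Finset.univ.map ⟨v, hinj⟩) (by simpa using hP)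
    simp at this
  · intro h T hT
    by_contra hc
    push Not at hc
    obtain ⟨T', hT', hcard⟩ := Finset.exists_subset_card_eq (show K + 1 ≤ T.card from hc)
    refine h ⟨fun i => T'.orderEmbOfFin hcard i, fun j k hjk => by simpa using hjk, fun j =>
      hT _ (hT' (Finset.orderEmbOfFin_mem _ _ _))⟩

theorem enum {P : S × ℤ → Prop} (hP : Dfn L P) (K : ℕ) :
    ∃ G : Fin (K + 1) → S × ℤ → Prop, (∀ i, Dfn L (G i)) ∧
      (∀ i s x x', G i (s, x) → G i (s, x') → x = x') ∧
      ∀ s, AtMost K (fun x => P (s, x)) → ∀ x, P (s, x) → ∃ i, G i (s, x) := by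
  let Lo : ℕ → S × ℤ → Prop := fun i p => ∃ v : Fin i → ℤ, (∀ j k, j ≠ k → v j ≠ v k) ∧
    ∀ j, v j < p.2 ∧ P (p.1, v j)
  have hLo : ∀ i, Dfn L (Lo i) := fun i => dfn
  refine ⟨fun i p => P p ∧ Lo i p ∧ ¬ Lo (i + 1) p, fun i =>
    hP.and ((hLo _).and (hLo _).not), ?_, ?_⟩
  · have key : ∀ (i : ℕ) s x x', x < x' → P (s, x) → Lo i (s, x) → Lo (i + 1) (s, x') := by
      rintro i s x x' hlt hx ⟨v, h1, h2⟩
      refine ⟨Fin.cons x v, fun j k => ?_, fun j => ?_⟩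
      · refine Fin.cases ?_ (fun j => ?_) j <;> refine Fin.cases ?_ (fun k => ?_) k
        · simp
        · intro _
          simpa using ((h2 k).1).ne'
        · intro _
          simpa using ((h2 j).1).ne
        · intro h
          simpa using h1 j k (by simpa using h)
      · refine Fin.cases ?_ (fun j => ?_) j
        · simpa using ⟨hlt, hx⟩
        · simpa using ⟨(h2 j).1.trans hlt, (h2 j).2⟩
    rintro i s x x' ⟨h1, h2, h3⟩ ⟨h1', h2', h3'⟩
    rcases lt_trichotomy x x' with h | h | h
    · exact absurd (key i s x x' h h1 h2) h3'
    · exact h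
    · exact absurd (key i s x' x h h1' h2') h3
  · intro s hs x hx
    by_contra hcon
    have : ∀ i : ℕ, i ≤ K + 1 → Lo i (s, x) := by
      intro i
      induction i with
      | zero => exact fun _ => ⟨Fin.elim0, fun j => j.elim0, fun j => j.elim0⟩
      | succ i ih =>
        intro hi
        by_contra hno
        exact hcon ⟨⟨i, by omega⟩, hx, ih (by omega), hno⟩
    obtain ⟨v, h1, h2⟩ := this (K + 1) le_rfl
    exact atMost_iff.1 hs ⟨v, h1, fun j => (h2 j).2⟩

/-- fibre structure of a definable family of functions -/
theorem fibres (H : Mnl L) {F : S × ℤ × ℤ → Prop} (hF : Dfn L F)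
    (hfun : ∀ c b a a', F (c, b, a) → F (c, b, a') → a = a') :
    ∃ K' K'' : ℕ, ∀ c, AtMost K'' (fun a => ¬ AtMost K' (fun b => F (c, b, a))) := by
  obtain ⟨d, hd, K, hK⟩ := lemUT H (X := fun p : (S × ℤ) × ℤ => F (p.1.1, p.2, p.1.2)) dfn
  obtain ⟨e0, he0, hUZ⟩ := lemUT H (X := fun p : S × ℤ =>
    ∃ a, F (p.1, p.2, a) ∧ F (p.1, p.2 + d, a)) dfn
  obtain ⟨K2, hK2⟩ := hUZ.mul d.toNat
  lift e0 to ℕ using by omega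
  rw [Int.toNat_of_nonneg (by omega), mul_comm] at hK2
  refine ⟨e0 * K, K2 + d.toNat, fun c => ?_⟩
  have hrun : ∀ a, ¬ AtMost (e0 * K) (fun b => F (c, b, a)) →
      ∃ x, ∀ i : ℕ, i ≤ e0 → F (c, x + d * i, a) := by
    intro a ha
    by_contra hcon
    push Not at hcon
    refine ha (AtMost.cover (fun i _ => (hK (c, a)).shift (d * i)) fun x hx => ?_)
    obtain ⟨n, hn, hnF⟩ := hcon x
    have hb : Brk (fun x => F (c, x, a)) (d * n) x := fun h => hnF (h.1 hx)
    obtain ⟨i, hi, h⟩ := brk_mul hb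
    exact ⟨i, by omega, h⟩
  have hdich : ∀ a, ¬ AtMost (e0 * K) (fun b => F (c, b, a)) →
      (∃ y, F (c, y, a) ∧ Brk (fun x => ∃ a, F (c, x, a) ∧ F (c, x + d, a)) (d * e0) y) ∨
      ∃ x, ∀ i : ℕ, F (c, x + d * i, a) := by
    intro a ha
    obtain ⟨x, hx⟩ := hrun a ha
    by_cases hall : ∀ i : ℕ, F (c, x + d * i, a)
    · exact Or.inr ⟨x, hall⟩
    · left
      push Not at hall
      classical
      have hlt : ∀ i < Nat.find hall, F (c, x + d * i, a) := fun i hi => by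
        have := Nat.find_min hall hi
        push Not at this
        exact this
      have hspec := Nat.find_spec hall
      set i0 := Nat.find hall
      have hi0 : e0 < i0 := by
        by_contra h
        exact hspec (hx _ (by omega))
      obtain ⟨r, hr⟩ : ∃ r, i0 = e0 + 1 + r := ⟨i0 - (e0 + 1), by omega⟩
      refine ⟨x + d * r, hlt r (by omega), fun hiff => ?_⟩
      have h1 : ∃ a, F (c, x + d * r, a) ∧ F (c, x + d * r + d, a) := by
        refine ⟨a, hlt r (by omega), ?_⟩
        have := hlt (r + 1) (by omega)
        push_cast at this
        rwa [mul_add, mul_one, ← add_assoc] at this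
      obtain ⟨a', h2, h3⟩ := hiff.1 h1
      have h4 := hlt (r + e0) (by omega)
      push_cast at h4
      rw [mul_add, ← add_assoc] at h4
      obtain rfl := hfun _ _ _ _ h2 h4
      apply hspec
      rw [hr]
      push_cast
      convert h3 using 3
      ring
  intro A hA
  classical
  have hA' : ∀ a ∈ A, (∃ y, F (c, y, a) ∧
      Brk (fun x => ∃ a, F (c, x, a) ∧ F (c, x + d, a)) (d * e0) y) ∨
      ∃ x, ∀ i : ℕ, F (c, x + d * i, a) := fun a ha => hdich a (hA a ha)
  rw [← Finset.card_filter_add_card_filter_not (fun a => (∃ y, F (c, y, a) ∧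
      Brk (fun x => ∃ a, F (c, x, a) ∧ F (c, x + d, a)) (d * e0) y))]
  refine add_le_add ?_ ?_
  · have h1 : ∀ a ∈ A.filter (fun a => (∃ y, F (c, y, a) ∧
      Brk (fun x => ∃ a, F (c, x, a) ∧ F (c, x + d, a)) (d * e0) y)), ∃ y, F (c, y, a) ∧
      Brk (fun x => ∃ a, F (c, x, a) ∧ F (c, x + d, a)) (d * e0) y := fun a ha =>
        (Finset.mem_filter.1 ha).2
    choose! y hy hyb using h1
    rw [← Finset.card_image_of_injOn (f := y)]
    · refine hK2 c _ fun x hx => ?_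
      obtain ⟨a, ha, rfl⟩ := Finset.mem_image.1 hx
      exact hyb a ha
    · intro a ha a' ha' h
      have h2 := hy a ha
      rw [h] at h2
      exact hfun _ _ _ _ h2 (hy a' ha')
  · have h1 : ∀ a ∈ A.filter (fun a => ¬ (∃ y, F (c, y, a) ∧
      Brk (fun x => ∃ a, F (c, x, a) ∧ F (c, x + d, a)) (d * e0) y)), ∃ x, ∀ i : ℕ,
        F (c, x + d * i, a) := fun a ha =>
        (hA' a (Finset.mem_filter.1 ha).1).resolve_left (Finset.mem_filter.1 ha).2
    choose! x hx using h1
    rw [← Finset.card_image_of_injOn (f := fun a => x a % d)]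
    · refine (Finset.card_le_card (t := Finset.Ico 0 d) fun z hz => ?_).trans (by simp)
      obtain ⟨a, ha, rfl⟩ := Finset.mem_image.1 hz
      exact Finset.mem_Ico.2 ⟨Int.emod_nonneg _ (by omega), Int.emod_lt_of_pos _ (by omega)⟩
    · intro a ha a' ha' h
      simp only at h
      obtain ⟨z, hz⟩ : d ∣ x a' - x a := Int.ModEq.dvd h
      rcases le_total 0 z with h0 | h0
      · lift z to ℕ using h0
        have h2 := hx a ha z
        have h3 := hx a' ha' 0
        rw [← hz] at h2
        simp only [add_sub_cancel, Nat.cast_zero, mul_zero, add_zero] at h2 h3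
        exact hfun _ _ _ _ h2 h3
      · obtain ⟨z, rfl⟩ : ∃ z' : ℕ, z = -z' := ⟨(-z).toNat, by omega⟩
        have h2 := hx a' ha' z
        have h3 := hx a ha 0
        rw [show x a' + d * z = x a by linarith] at h2
        simp only [Nat.cast_zero, mul_zero, add_zero] at h3
        exact hfun _ _ _ _ h3 h2

theorem EPZ (H : Mnl L) {F : S × ℤ × ℤ → Prop} (hF : Dfn L F)
    (hfun : ∀ c b a a', F (c, b, a) → F (c, b, a') → a = a') :
    ∃ (k l : ℕ) (θ : Fin k → (S × ℤ) × ℤ → Prop) (η : Fin l → S × ℤ → Prop),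
      (∀ i, Dfn L (θ i)) ∧ (∀ i, Dfn L (η i)) ∧
      (∀ i s x x', θ i (s, x) → θ i (s, x') → x = x') ∧
      (∀ i s x x', η i (s, x) → η i (s, x') → x = x') ∧
      ∀ c b a, F (c, b, a) → (∃ i, θ i ((c, a), b)) ∨ ∃ i, η i (c, a) := by
  obtain ⟨K', K'', h⟩ := fibres H hF hfun
  obtain ⟨θ, h1, h2, h3⟩ := enum (P := fun p : (S × ℤ) × ℤ => F (p.1.1, p.2, p.1.2))
    dfn K'
  obtain ⟨η, h4, h5, h6⟩ := enum (L := L) (P := fun p : S × ℤ => ∃ v : Fin (K' + 1) → ℤ,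
    (∀ j k, j ≠ k → v j ≠ v k) ∧ ∀ j, F (p.1, v j, p.2)) dfn K''
  refine ⟨_, _, θ, η, h1, h4, h2, h5, fun c b a hab => ?_⟩
  by_cases hc : AtMost K' (fun b => F (c, b, a))
  · exact Or.inl (h3 (c, a) hc b hab)
  · right
    refine h6 c ((h c).mono (fun x hx => ?_) le_rfl) a ?_
    · rw [atMost_iff, not_not]; exact hx
    · rw [atMost_iff, not_not] at hc; exact hc

end Exchange

section Transfer
open FirstOrder.Language
variable {L : Language} [L.Structure ℤ]

theorem transfer {M : Type} [L.Structure M] (hM : ℤ ≅[L] M) {α : Type} [Finite α]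
    (χ : L.Formula α) (h : ∀ v : α → ℤ, χ.Realize v) (v : α → M) : χ.Realize v := by
  have key : ∀ (N : Type) [L.Structure N],
      (N ⊨ (Formula.iAlls α (χ.relabel Sum.inr : L.Formula (Empty ⊕ α)) : L.Sentence)) ↔
      ∀ v : α → N, χ.Realize v := by
    intro N _
    rw [Sentence.Realize, Formula.realize_iAlls]
    refine forall_congr' fun v => ?_
    rw [Formula.realize_relabel]
    rfl
  exact (key M).1 ((elementarilyEquivalent_iff.1 hM _).1 ((key ℤ).2 h)) v

theorem uniq_transfer {M : Type} [L.Structure M] (hM : ℤ ≅[L] M) {γ : Type} [Finite γ]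
    (χ : L.Formula (γ ⊕ Unit))
    (h : ∀ (p : γ → ℤ) (x x' : ℤ), χ.Realize (Sum.elim p (fun _ => x)) →
      χ.Realize (Sum.elim p (fun _ => x')) → x = x')
    (p : γ → M) (x x' : M) (h1 : χ.Realize (Sum.elim p (fun _ => x)))
    (h2 : χ.Realize (Sum.elim p (fun _ => x'))) : x = x' := by
  let χ' : L.Formula (γ ⊕ (Unit ⊕ Unit)) :=
    (χ.relabel (Sum.map id Sum.inl)).imp ((χ.relabel (Sum.map id Sum.inr)).imp
      (Term.equal (Term.var (Sum.inr (Sum.inl ()))) (Term.var (Sum.inr (Sum.inr ())))))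
  have key : ∀ (N : Type) [L.Structure N] (v : γ ⊕ (Unit ⊕ Unit) → N),
      χ'.Realize v ↔ (χ.Realize (Sum.elim (v ∘ Sum.inl) (fun _ => v (Sum.inr (Sum.inl ())))) →
        χ.Realize (Sum.elim (v ∘ Sum.inl) (fun _ => v (Sum.inr (Sum.inr ())))) →
        v (Sum.inr (Sum.inl ())) = v (Sum.inr (Sum.inr ()))) := by
    intro N _ v
    simp only [χ', Formula.realize_imp, Formula.realize_relabel, Formula.realize_equal,
      Term.realize_var]
    have e1 : v ∘ Sum.map id Sum.inl =
      (Sum.elim (v ∘ Sum.inl) (fun _ => v (Sum.inr (Sum.inl ()))) : γ ⊕ Unit → N) := by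
      funext i; rcases i with i | i <;> rfl
    have e2 : v ∘ Sum.map id Sum.inr =
      (Sum.elim (v ∘ Sum.inl) (fun _ => v (Sum.inr (Sum.inr ()))) : γ ⊕ Unit → N) := by
      funext i; rcases i with i | i <;> rfl
    rw [e1, e2]
  have := (key M _).1 (transfer hM χ' (fun v => (key ℤ v).2 (h _ _ _))
    (Sum.elim p (Sum.elim (fun _ => x) (fun _ => x'))))
  exact this h1 h2

theorem dcl_of {M : Type} [L.Structure M] {γ : Type} (χ : L.Formula (γ ⊕ Unit)) {B : Set M}
    (p : γ → M) (hp : ∀ g, p g ∈ B) (a : M)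
    (h : ∀ x, χ.Realize (Sum.elim p (fun _ => x)) ↔ x = a) : a ∈ dcl L M B := by
  refine Set.definable_iff_exists_formula_sum.2
    ⟨χ.relabel (Sum.map (fun g => ⟨p g, hp g⟩) (fun _ => 0)), ?_⟩
  ext v
  simp only [Set.mem_ofPred_eq, Set.mem_singleton_iff, Formula.realize_relabel]
  rw [← h]
  have : (Sum.elim Subtype.val v ∘ Sum.map (fun g => ⟨p g, hp g⟩) (fun _ => 0) : γ ⊕ Unit → M) =
      Sum.elim p (fun _ => v 0) := by
    funext i; rcases i with i | i <;> rfl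
  rw [← this]

theorem of_dcl {M : Type} [L.Structure M] {A : Set M} {a b : M} (h : a ∈ dcl L M (A ∪ {b})) :
    ∃ (β : Type) (_ : Finite β) (p : β → M) (ψ : L.Formula (β ⊕ (Unit ⊕ Unit))),
      (∀ i, p i ∈ A) ∧
      ∀ y, ψ.Realize (Sum.elim p (Sum.elim (fun _ => b) (fun _ => y))) ↔ y = a := by
  classical
  obtain ⟨A0, hA0, h⟩ := Set.definable_iff_finitely_definable.1 h
  obtain ⟨φ, hφ⟩ := Set.definable_iff_exists_formula_sum.1 h
  refine ⟨{x : M // x ∈ A0 ∧ x ∈ A}, ?_, Subtype.val, φ.relabel (Sum.elim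
    (fun x => if hx : x.1 ∈ A then Sum.inl ⟨x.1, x.2, hx⟩ else Sum.inr (Sum.inl ()))
    (fun _ => Sum.inr (Sum.inr ()))), fun i => i.2.2, fun y => ?_⟩
  · exact Finite.of_injective (β := A0) (fun x => ⟨x.1, x.2.1⟩) fun x y h => by
      simpa [Subtype.ext_iff] using h
  · rw [Formula.realize_relabel]
    have h2 := Set.ext_iff.1 hφ (fun _ => y)
    simp only [Set.mem_ofPred_eq, Set.mem_singleton_iff] at h2
    rw [h2]
    refine iff_of_eq (congrArg _ ?_)
    funext i
    rcases i with i | i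
    · by_cases hi : i.1 ∈ A
      · simp [hi]
      · have : i.1 = b := by
          have := hA0 i.2
          simpa [hi] using this
        simp only [Function.comp_apply, Sum.elim_inl, dif_neg hi, Sum.elim_inr]
        exact this.symm
    · rfl

/-- the functional part of a formula -/
noncomputable def funPart {β : Type} (ψ : L.Formula (β ⊕ (Unit ⊕ Unit))) : L.Formula (β ⊕ (Unit ⊕ Unit)) :=
  ψ ⊓ Formula.iAlls Unit ((ψ.relabel (Sum.elim (fun b => Sum.inl (Sum.inl b))
    (Sum.elim (fun _ => Sum.inl (Sum.inr (Sum.inl ()))) (fun _ => Sum.inr ()))) :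
      L.Formula ((β ⊕ (Unit ⊕ Unit)) ⊕ Unit)).imp
    (Term.equal (Term.var (Sum.inr ())) (Term.var (Sum.inl (Sum.inr (Sum.inr ()))))))

theorem realize_funPart {β : Type} (ψ : L.Formula (β ⊕ (Unit ⊕ Unit))) {N : Type}
    [L.Structure N] (c : β → N) (b a : N) :
    (funPart ψ).Realize (Sum.elim c (Sum.elim (fun _ => b) (fun _ => a))) ↔
      ψ.Realize (Sum.elim c (Sum.elim (fun _ => b) (fun _ => a))) ∧
      ∀ a', ψ.Realize (Sum.elim c (Sum.elim (fun _ => b) (fun _ => a'))) → a' = a := by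
  rw [funPart, Formula.realize_inf, Formula.realize_iAlls]
  refine and_congr_right fun _ => ?_
  have key : ∀ i : Unit → N, ((fun x : (β ⊕ (Unit ⊕ Unit)) ⊕ Unit =>
      Sum.elim (Sum.elim c (Sum.elim (fun _ => b) (fun _ => a))) i x) ∘ (Sum.elim (fun b => Sum.inl (Sum.inl b))
    (Sum.elim (fun _ => Sum.inl (Sum.inr (Sum.inl ()))) (fun _ => Sum.inr ())))
      : β ⊕ (Unit ⊕ Unit) → N) =
    Sum.elim c (Sum.elim (fun _ => b) (fun _ => i ())) := by
    intro i; funext x; rcases x with x | x | x <;> rfl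
  simp only [Formula.realize_imp, Formula.realize_relabel, key, Formula.realize_equal,
      Term.realize_var, Sum.elim_inl, Sum.elim_inr]
  exact ⟨fun h a' => h (fun _ => a'), fun h i => h (i ())⟩

theorem EP_of_Mnl [Arith L] (H : Mnl L) : HasEP L := by
  intro M _ hM A a b hab ha
  obtain ⟨β, _, p, ψ, hp, hψ⟩ := of_dcl hab
  have eF : ∀ c b a, (Crd.e ((c, b, a) : (β → ℤ) × ℤ × ℤ)) =
      (Sum.elim c (Sum.elim (fun _ => b) (fun _ => a))) := by
    intro c b a
    funext i; rcases i with i | i | i <;> rfl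
  have rF : ∀ (c : β → ℤ) (b a : ℤ),
      (funPart ψ).Realize (Crd.e ((c, b, a) : (β → ℤ) × ℤ × ℤ)) ↔
      (funPart ψ).Realize (Sum.elim c (Sum.elim (fun _ => b) (fun _ => a))) :=
    fun c b a => iff_of_eq (congrArg _ (eF c b a))
  obtain ⟨k, l, θ, η, hθ, hη, hθu, hηu, hcov⟩ := EPZ (L := L) H (S := β → ℤ)
    (F := fun q => (funPart ψ).Realize (Crd.e q)) ⟨funPart ψ, fun g => Iff.rfl⟩ (by
      intro c b a a' h h'
      replace h := (realize_funPart ψ _ _ _).1 ((rF _ _ _).1 h)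
      replace h' := (realize_funPart ψ _ _ _).1 ((rF _ _ _).1 h')
      exact h'.2 _ h.1)
  choose θ' hθ' using hθ
  choose η' hη' using hη
  have eθ : ∀ (c : β → ℤ) (a b : ℤ), (Crd.e (((c, a), b) : ((β → ℤ) × ℤ) × ℤ)) =
      (Sum.elim (Sum.elim c (fun _ => a)) (fun _ => b)) := by
    intro c b a
    funext i; rcases i with (i | i) | i <;> rfl
  have eη : ∀ (c : β → ℤ) (a : ℤ), (Crd.e ((c, a) : (β → ℤ) × ℤ)) =
      (Sum.elim c (fun _ => a)) := by
    intro c a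
    funext i; rcases i with i | i <;> rfl
  have : Finite (β ⊕ (Unit ⊕ Unit)) := inferInstance
  let θ'' : Fin k → L.Formula ((β ⊕ Unit) ⊕ Unit) := θ'
  let η'' : Fin l → L.Formula (β ⊕ Unit) := η'
  have rθ : ∀ i c a b, (θ'' i).Realize (Sum.elim (Sum.elim c (fun _ => a)) (fun _ => b)) ↔
      θ i ((c, a), b) := fun i c a b =>
    (iff_of_eq (congrArg (θ' i).Realize (eθ c a b).symm)).trans (hθ' i _)
  have rη : ∀ i c a, (η'' i).Realize (Sum.elim c (fun _ => a)) ↔ η i (c, a) := fun i c a =>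
    (iff_of_eq (congrArg (η' i).Realize (eη c a).symm)).trans (hη' i _)
  let χ : L.Formula (β ⊕ (Unit ⊕ Unit)) := (funPart ψ).imp
    ((Formula.iSup fun i => (θ'' i).relabel (Sum.elim (Sum.elim Sum.inl
      (fun _ => Sum.inr (Sum.inr ()))) (fun _ => Sum.inr (Sum.inl ())))) ⊔
     (Formula.iSup fun i => (η'' i).relabel (Sum.elim Sum.inl
      (fun _ => Sum.inr (Sum.inr ())))))
  have key : ∀ (N : Type) [L.Structure N] (c : β → N) (b a : N),
      χ.Realize (Sum.elim c (Sum.elim (fun _ => b) (fun _ => a))) ↔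
      ((funPart ψ).Realize (Sum.elim c (Sum.elim (fun _ => b) (fun _ => a))) →
      (∃ i, (θ'' i).Realize (Sum.elim (Sum.elim c (fun _ => a)) (fun _ => b))) ∨
      ∃ i, (η'' i).Realize (Sum.elim c (fun _ => a))) := by
    intro N _ c b a
    have e1 : (Sum.elim c (Sum.elim (fun _ => b) (fun _ => a))) ∘ (Sum.elim (Sum.elim Sum.inl
      (fun _ => Sum.inr (Sum.inr ()))) (fun _ => Sum.inr (Sum.inl ()))) =
      (Sum.elim (Sum.elim c (fun _ => a)) (fun _ => b) : (β ⊕ Unit) ⊕ Unit → N) := by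
      funext i; rcases i with (i | i) | i <;> rfl
    have e2 : (Sum.elim c (Sum.elim (fun _ : Unit => b) (fun _ : Unit => a))) ∘ (Sum.elim Sum.inl
      (fun _ => Sum.inr (Sum.inr ()))) =
      (Sum.elim c (fun _ => a) : β ⊕ Unit → N) := by
      funext i; rcases i with i | i <;> rfl
    simp only [χ, Formula.realize_imp, Formula.realize_sup, Formula.realize_iSup,
      Formula.realize_relabel, e1, e2]
  have hχ : χ.Realize (Sum.elim p (Sum.elim (fun _ => b) (fun _ => a))) := by
    refine transfer hM χ (fun v => ?_) _
    have ev : v = Sum.elim (v ∘ Sum.inl) (Sum.elim (fun _ => v (Sum.inr (Sum.inl ())))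
        (fun _ => v (Sum.inr (Sum.inr ())))) := by
      funext i; rcases i with i | i | i <;> rfl
    rw [ev, key]
    intro h
    rcases hcov _ _ _ ((rF _ _ _).2 h) with ⟨i, hi⟩ | ⟨i, hi⟩
    · exact Or.inl ⟨i, (rθ _ _ _ _).2 hi⟩
    · exact Or.inr ⟨i, (rη _ _ _).2 hi⟩
  rw [key] at hχ
  have hF : (funPart ψ).Realize (Sum.elim p (Sum.elim (fun _ => b) (fun _ => a))) := by
    rw [realize_funPart]
    exact ⟨(hψ a).2 rfl, fun a' h => (hψ a').1 h⟩
  rcases hχ hF with ⟨i, hi⟩ | ⟨i, hi⟩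
  · refine dcl_of (θ'' i) (Sum.elim p (fun _ => a)) ?_ b fun x => ⟨fun hx => ?_, ?_⟩
    · rintro (g | g)
      · exact Or.inl (hp g)
      · exact Or.inr rfl
    · refine uniq_transfer hM (θ'' i) (fun q x x' h h' => ?_) _ x b hx hi
      have eq : q = Sum.elim (q ∘ Sum.inl) (fun _ => q (Sum.inr ())) := by
        funext i; rcases i with i | i <;> rfl
      rw [eq] at h h'
      exact hθu i _ x x' ((rθ _ _ _ _).1 h) ((rθ _ _ _ _).1 h')
    · rintro rfl; exact hi
  · refine absurd (dcl_of (η'' i) p hp a fun x => ⟨fun hx => ?_, ?_⟩) ha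
    · refine uniq_transfer hM (η'' i) (fun q x x' h h' => ?_) _ x a hx hi
      exact hηu i _ x x' ((rη _ _ _).1 h) ((rη _ _ _).1 h')
    · rintro rfl; exact hi

end Transfer

section Forward
open FirstOrder.Language
variable {L : Language} [L.Structure ℤ]

theorem ultra_realize {I : Type} (u : Ultrafilter I) {β : Type} (ψ : L.Formula (β ⊕ (Unit ⊕ Unit)))
    (z a y : I → ℤ) :
    ψ.Realize (Sum.elim (fun _ => (z : (u : Filter I).Product (fun _ => ℤ)))
      (Sum.elim (fun _ => (a : (u : Filter I).Product (fun _ => ℤ)))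
        (fun _ => (y : (u : Filter I).Product (fun _ => ℤ))))) ↔
    ∀ᶠ i in u, ψ.Realize (Sum.elim (fun _ => z i) (Sum.elim (fun _ => a i) (fun _ => y i))) := by
  have := Ultraproduct.realize_formula_cast (M := fun _ : I => ℤ) (u := u) ψ
    (Sum.elim (fun _ => z) (Sum.elim (fun _ => a) (fun _ => y)))
  convert this using 2
  · funext i; rcases i with i | i | i <;> rfl
  · funext j
    refine congrArg _ ?_
    funext i; rcases i with i | i | i <;> rfl

theorem ultra_eq {I : Type} (u : Ultrafilter I) (a y : I → ℤ) :
    ((a : (u : Filter I).Product (fun _ => ℤ)) = (y : (u : Filter I).Product (fun _ => ℤ))) ↔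
    ∀ᶠ i in u, a i = y i := Quotient.eq'

theorem EP_fin (hEP : HasEP L) {R : ℤ × ℤ × ℤ → Prop} (hR : Dfn L R)
    (hfun : ∀ z b a a', R (z, b, a) → R (z, b, a') → a = a') :
    ∃ (G : Finset (ℤ → ℤ)) (H : Finset (ℤ → ℤ → ℤ)), ∀ z b a, R (z, b, a) →
      (∃ g ∈ G, a = g z) ∨ ∃ h ∈ H, b = h z a := by
  by_contra hcon
  push Not at hcon
  choose z b a hRa hG hH using hcon
  classical
  let I := Finset (ℤ → ℤ) × Finset (ℤ → ℤ → ℤ)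
  let u : Ultrafilter I := Ultrafilter.of Filter.atTop
  have hu : (u : Filter I) ≤ Filter.atTop := Ultrafilter.of_le _
  let M := (u : Filter I).Product (fun _ => ℤ)
  let z' : I → ℤ := fun i => z i.1 i.2
  let a' : I → ℤ := fun i => a i.1 i.2
  let b' : I → ℤ := fun i => b i.1 i.2
  have hM : ℤ ≅[L] M := elementarilyEquivalent_iff.2 fun φ => by
    rw [Ultraproduct.sentence_realize, Filter.eventually_const]
  let zM : M := (z' : (u : Filter I).Product (fun _ => ℤ))
  let aM : M := (a' : (u : Filter I).Product (fun _ => ℤ))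
  let bM : M := (b' : (u : Filter I).Product (fun _ => ℤ))
  obtain ⟨ρ, hρ⟩ := hR
  have h1 : aM ∈ dcl L M ({zM} ∪ {bM}) := by
    let ρ' : L.Formula (Unit ⊕ (Unit ⊕ Unit)) := ρ
    refine dcl_of (ρ'.relabel (Sum.elim (fun _ => Sum.inl (Sum.inl ())) (Sum.elim
      (fun _ => Sum.inl (Sum.inr ())) (fun _ => Sum.inr ()))) : L.Formula ((Unit ⊕ Unit) ⊕ Unit))
      (Sum.elim (fun _ => zM) (fun _ => bM)) ?_ aM ?_
    · rintro (g | g)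
      · exact Or.inl rfl
      · exact Or.inr rfl
    · intro x
      obtain ⟨y, rfl⟩ : ∃ y : I → ℤ, (y : (u : Filter I).Product (fun _ => ℤ)) = x :=
        Quotient.exists_rep x
      rw [Formula.realize_relabel]
      have e : (Sum.elim (Sum.elim (fun _ => zM) (fun _ => bM))
          (fun _ => (y : (u : Filter I).Product (fun _ => ℤ)))) ∘
          (Sum.elim (fun _ => Sum.inl (Sum.inl ())) (Sum.elim
          (fun _ => Sum.inl (Sum.inr ())) (fun _ => Sum.inr ())) :
            Unit ⊕ (Unit ⊕ Unit) → (Unit ⊕ Unit) ⊕ Unit) =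
          Sum.elim (fun _ => (z' : (u : Filter I).Product (fun _ => ℤ)))
            (Sum.elim (fun _ => (b' : (u : Filter I).Product (fun _ => ℤ)))
            (fun _ => (y : (u : Filter I).Product (fun _ => ℤ)))) := by
        funext i; rcases i with i | i | i <;> rfl
      have hr : ∀ p q r, ρ'.Realize (Sum.elim (fun _ => p) (Sum.elim (fun _ => q) (fun _ => r))) ↔
          R (p, q, r) := by
        intro p q r
        refine Iff.trans (iff_of_eq (congrArg ρ.Realize ?_)) (hρ (p, q, r))
        funext i; rcases i with i | i | i <;> rfl
      rw [e]
      refine Iff.trans (ultra_realize u ρ' z' b' y) (Iff.trans ?_ (ultra_eq u y a').symm)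
      refine Filter.eventually_congr (Filter.Eventually.of_forall fun j => ?_)
      rw [hr]
      constructor
      · intro h; exact hfun _ _ _ _ h (hRa j.1 j.2)
      · intro h; rw [h]; exact hRa j.1 j.2
  have h2 : aM ∉ dcl L M {zM} := by
    intro h
    rw [← Set.union_self {zM}] at h
    obtain ⟨β, _, p, ψ, hp, hψ⟩ := of_dcl h
    have hp' : p = fun _ => zM := funext hp
    rw [hp'] at hψ
    let g : ℤ → ℤ := fun z => Classical.epsilon fun y =>
      ψ.Realize (Sum.elim (fun _ => z) (Sum.elim (fun _ => z) (fun _ => y)))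
    have hev := (ultra_realize u ψ z' z' a').1 ((hψ aM).2 rfl)
    have hg : ∀ᶠ i in u, ψ.Realize (Sum.elim (fun _ => z' i) (Sum.elim (fun _ => z' i)
        (fun _ => g (z' i)))) := hev.mono fun i hi => Classical.epsilon_spec (p := fun y =>
      ψ.Realize (Sum.elim (fun _ => z' i) (Sum.elim (fun _ => z' i) (fun _ => y)))) ⟨_, hi⟩
    have he := (ultra_eq u _ a').1 ((hψ _).1 ((ultra_realize u ψ z' z' (fun i => g (z' i))).2 hg))
    have hge : ∀ᶠ i in u, (({g}, ∅) : I) ≤ i := hu (Filter.eventually_ge_atTop _)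
    obtain ⟨i, hi, hi'⟩ := (he.and hge).exists
    exact hG i.1 i.2 g (by simpa using hi'.1) hi.symm
  have h3 := hEP M hM {zM} aM bM h1 h2
  obtain ⟨β, _, p, ψ, hp, hψ⟩ := of_dcl h3
  have hp' : p = fun _ => zM := funext hp
  rw [hp'] at hψ
  let g : ℤ → ℤ → ℤ := fun z a => Classical.epsilon fun y =>
    ψ.Realize (Sum.elim (fun _ => z) (Sum.elim (fun _ => a) (fun _ => y)))
  have hev := (ultra_realize u ψ z' a' b').1 ((hψ bM).2 rfl)
  have hg : ∀ᶠ i in u, ψ.Realize (Sum.elim (fun _ => z' i) (Sum.elim (fun _ => a' i)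
      (fun _ => g (z' i) (a' i)))) := hev.mono fun i hi => Classical.epsilon_spec (p := fun y =>
    ψ.Realize (Sum.elim (fun _ => z' i) (Sum.elim (fun _ => a' i) (fun _ => y)))) ⟨_, hi⟩
  have he := (ultra_eq u _ b').1
    ((hψ _).1 ((ultra_realize u ψ z' a' (fun i => g (z' i) (a' i))).2 hg))
  have hge : ∀ᶠ i in u, ((∅, {g}) : I) ≤ i := hu (Filter.eventually_ge_atTop _)
  obtain ⟨i, hi, hi'⟩ := (he.and hge).exists
  exact hH i.1 i.2 g (by simpa using hi'.2) hi.symm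

theorem gap_bound [Arith L] (hEP : HasEP L) {X : ℤ → Prop} (hX : Dfn L X) :
    ∃ K : ℕ, ∀ z, AtMost K (fun a => ¬ (X a ↔ X (a + z)) ∧
      ∀ y, a < y → y ≤ a + K → (X y ↔ X (y + z))) := by
  obtain ⟨G, H, hGH⟩ := EP_fin hEP (L := L) (R := fun p : ℤ × ℤ × ℤ =>
    ¬ (X p.2.2 ↔ X (p.2.2 + p.1)) ∧ p.2.2 ≤ p.2.1 ∧
      ∀ y, p.2.2 < y → y ≤ p.2.1 → (X y ↔ X (y + p.1))) dfn (by
    rintro z b a a' ⟨h1, h2, h3⟩ ⟨h1', h2', h3'⟩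
    simp only at *
    rcases lt_trichotomy a a' with h | h | h
    · exact absurd (h3 a' h h2') h1'
    · exact h
    · exact absurd (h3' a h h2) h1)
  classical
  refine ⟨G.card + H.card, fun z T hT => ?_⟩
  by_contra hlt
  push Not at hlt
  obtain ⟨a, haT, ha⟩ : ∃ a ∈ T, a ∉ G.image (fun g => g z) :=
    Finset.exists_mem_notMem_of_card_lt_card ((Finset.card_image_le).trans_lt (by omega))
  obtain ⟨b, hbT, hb⟩ : ∃ b ∈ Finset.Icc a (a + (G.card + H.card : ℕ)),
      b ∉ H.image (fun h => h z a) :=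
    Finset.exists_mem_notMem_of_card_lt_card ((Finset.card_image_le).trans_lt (by
      rw [Int.card_Icc]; omega))
  rw [Finset.mem_Icc] at hbT
  obtain ⟨h1, h2⟩ := hT a haT
  rcases hGH z b a ⟨h1, hbT.1, fun y hy hy' => h2 y hy (hy'.trans hbT.2)⟩ with ⟨g, hg, e⟩ | ⟨g, hg, e⟩
  · exact ha (Finset.mem_image.2 ⟨g, hg, e.symm⟩)
  · exact hb (Finset.mem_image.2 ⟨g, hg, e.symm⟩)

theorem AtMost.eventually_not {K : ℕ} {P : ℤ → Prop} (h : AtMost K P) : ∃ N, ∀ x, N ≤ x → ¬ P x := by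
  have hf : {x | P x}.Finite := by
    by_contra hinf
    obtain ⟨t, ht, hc⟩ := Set.Infinite.exists_subset_card_eq hinf (K + 1)
    have := h t fun x hx => ht hx
    omega
  obtain ⟨N, hN⟩ := hf.bddAbove
  exact ⟨N + 1, fun x hx hP => by have := hN hP; omega⟩

theorem Mnl_of_EP [Arith L] (hEP : HasEP L) : Mnl L := by
  intro X hX
  obtain ⟨K, hK⟩ := gap_bound hEP hX
  by_contra hcon
  push Not at hcon
  have hwin : ∀ z, 1 ≤ z → ∀ᶠ t : ℤ in Filter.atTop, ∃ i : Fin (K + 1),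
      ¬ (X (t + (i : ℕ)) ↔ X (t + (i : ℕ) + z)) := by
    intro z hz
    obtain ⟨N, hN⟩ := (hK z).eventually_not
    obtain ⟨y, hy, hyX⟩ := hcon z hz N
    have hyX' : ¬ (X y ↔ X (y + z)) := by tauto
    have hall : ∀ t, y ≤ t → ∃ w, N ≤ w ∧ ¬ (X w ↔ X (w + z)) ∧ w ≤ t ∧ t ≤ w + K := by
      intro t ht
      induction t, ht using Int.leInduction with
      | base => exact ⟨y, hy, hyX', le_rfl, by omega⟩
      | succ t ht ih =>
        obtain ⟨w, hw1, hw2, hw3, hw4⟩ := ih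
        by_cases h : t + 1 ≤ w + K
        · exact ⟨w, hw1, hw2, by omega, h⟩
        · have := hN w hw1
          have h2 : ∃ v, w < v ∧ v ≤ w + K ∧ ¬ (X v ↔ X (v + z)) := by
            by_contra hno
            push Not at hno
            exact this ⟨hw2, fun v h1 h2 => by have := hno v h1 h2; tauto⟩
          obtain ⟨v, hv1, hv2, hv3⟩ := h2
          exact ⟨v, by omega, hv3, by omega, by omega⟩
    refine Filter.eventually_atTop.2 ⟨y, fun t ht => ?_⟩
    obtain ⟨w, hw1, hw2, hw3, hw4⟩ := hall (t + K) (by omega)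
    refine ⟨⟨(w - t).toNat, by omega⟩, ?_⟩
    simp only
    rw [show t + ((w - t).toNat : ℤ) = w by omega]
    exact hw2
  classical
  let m : ℕ := Fintype.card (Fin (K + 1) → Prop)
  obtain ⟨t0, ht0⟩ := Filter.eventually_atTop.1 ((Finset.eventually_all (Finset.Icc (1 : ℤ) m)).2
    fun z hz => hwin z (Finset.mem_Icc.1 hz).1)
  obtain ⟨j, j', hne, hjj⟩ := Fintype.exists_ne_map_eq_of_card_lt
    (fun (j : Fin (m + 1)) (i : Fin (K + 1)) => X (t0 + (j : ℕ) + (i : ℕ)))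
    (by rw [Fintype.card_fin]; exact Nat.lt_succ_self _)
  have main : ∀ j j' : Fin (m + 1), j < j' →
      (∀ i : Fin (K + 1), X (t0 + (j : ℕ) + (i : ℕ)) = X (t0 + (j' : ℕ) + (i : ℕ))) → False := by
    intro j j' hlt he
    obtain ⟨i, hi⟩ := ht0 (t0 + (j : ℕ)) (by omega) ((j' : ℕ) - (j : ℕ) : ℤ)
      (Finset.mem_Icc.2 ⟨by have : (j : ℕ) < j' := hlt; omega, by have := j'.2; omega⟩)
    apply hi
    rw [he i]
    refine iff_of_eq (congrArg X ?_)
    ring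
  rcases lt_or_gt_of_ne hne with h | h
  · exact main _ _ h fun i => congrFun hjj i
  · exact main _ _ h fun i => (congrFun hjj i).symm

end Forward

section Final
open FirstOrder.Language
variable {L : Language} [L.Structure ℤ]

theorem arith_of (hlt : (∅ : Set ℤ).Definable L {v : Fin 2 → ℤ | v 0 < v 1})
    (hadd : (∅ : Set ℤ).Definable L {v : Fin 3 → ℤ | v 0 + v 1 = v 2})
    (hone : (∅ : Set ℤ).Definable₁ L ({1} : Set ℤ)) : Arith L := by
  have conv : ∀ (n : ℕ) (s : Set (Fin n → ℤ)), (∅ : Set ℤ).Definable L s →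
      Dfn L (fun v : Fin n → ℤ => v ∈ s) := by
    intro n s h
    obtain ⟨φ, rfl⟩ := Set.empty_definable_iff.1 h
    exact ⟨φ, fun g => Iff.rfl⟩
  refine ⟨?_, ?_, ?_⟩
  · refine (Dfn.relabel (conv _ _ hlt) (fun p : ℤ × ℤ => ![p.1, p.2])
      ![Sum.inl (), Sum.inr ()] ?_).congr fun g => ?_
    · intro g i; change Fin 2 at i; fin_cases i <;> rfl
    · simp
  · refine (Dfn.relabel (conv _ _ hadd) (fun p : (ℤ × ℤ) × ℤ => ![p.1.1, p.1.2, p.2])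
      ![Sum.inl (Sum.inl ()), Sum.inl (Sum.inr ()), Sum.inr ()] ?_).congr fun g => ?_
    · intro g i; change Fin 3 at i; fin_cases i <;> rfl
    · simp [eq_comm]
  · refine (Dfn.relabel (conv _ _ hone) (fun p : Unit × ℤ => ![p.2])
      ![Sum.inr ()] ?_).congr fun g => ?_
    · intro g i; change Fin 1 at i; fin_cases i; rfl
    · simp

theorem dfn_of_univ [Arith L] {X : Set ℤ} (h : (Set.univ : Set ℤ).Definable₁ L X) :
    Dfn L (fun x => x ∈ X) := by
  obtain ⟨A0, -, h⟩ := Set.definable_iff_finitely_definable.1 h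
  obtain ⟨φ, hφ⟩ := Set.definable_iff_exists_formula_sum.1 h
  let φ' : L.Formula (Crd.ι (((↥(A0 : Set ℤ)) → ℤ) × (Fin 1 → ℤ))) := φ
  have h1 : Dfn L (fun p : ((↥(A0 : Set ℤ)) → ℤ) × (Fin 1 → ℤ) => φ'.Realize (Crd.e p)) :=
    ⟨φ', fun g => Iff.rfl⟩
  refine (Dfn.comp h1 (f := fun x : ℤ => ((fun a => a.1), fun _ => x))
    (DFun.pair (DFun.constT _) (DFun.pi fun _ => DFun.id))).congr fun x => ?_
  have h2 := Set.ext_iff.1 hφ (fun _ => x)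
  simp only [Set.mem_ofPred_eq] at h2
  rw [h2]
  refine iff_of_eq (congrArg φ.Realize ?_)
  funext i; rcases i with i | i <;> rfl

theorem univ_of_dfn {P : ℤ → Prop} (h : Dfn L P) :
    (Set.univ : Set ℤ).Definable₁ L {x | P x} := by
  obtain ⟨φ, hφ⟩ := h
  refine Set.Definable.mono (A := ∅) (Set.empty_definable_iff.2
    ⟨(φ : L.Formula Unit).relabel (fun _ => (0 : Fin 1)), ?_⟩) (Set.empty_subset _)
  ext v
  simp only [Set.mem_ofPred_eq, Formula.realize_relabel]
  rw [← hφ]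
  exact iff_of_eq (congrArg φ.Realize rfl)

theorem per_mul {P : ℤ → Prop} {d N : ℤ} (hd : 1 ≤ d) (h : ∀ x, N ≤ x → (P x ↔ P (x + d)))
    (k : ℕ) : ∀ x, N ≤ x → (P x ↔ P (x + k * d)) := by
  induction k with
  | zero => intro x _; simp
  | succ k ih =>
    intro x hx
    rw [ih x hx, h (x + k * d) (by nlinarith [Int.natCast_nonneg k])]
    refine iff_of_eq (congrArg P ?_)
    push_cast; ring

end Final

theorem EP_iff_Pres_minimal (L : FirstOrder.Language) [L.Structure ℤ]
    (hlt : (∅ : Set ℤ).Definable L {v : Fin 2 → ℤ | v 0 < v 1})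
    (hadd : (∅ : Set ℤ).Definable L {v : Fin 3 → ℤ | v 0 + v 1 = v 2})
    (hone : (∅ : Set ℤ).Definable₁ L ({1} : Set ℤ)) :
    HasEP L ↔
      ∀ X : Set ℤ, (Set.univ : Set ℤ).Definable₁ L X →
        ∃ d : ℤ, 1 ≤ d ∧ ∃ N : ℕ,
          (∀ x : ℤ, (N : ℤ) ≤ x → (x ∈ X ↔ x + d ∈ X)) ∧
          (∀ x : ℤ, x ≤ -(N : ℤ) → (x ∈ X ↔ x - d ∈ X)) := by
  have : Arith L := arith_of hlt hadd hone
  constructor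
  · intro hEP X hX
    have H := Mnl_of_EP hEP
    have hX' := dfn_of_univ hX
    obtain ⟨d, hd, N, hN⟩ := H _ hX'
    obtain ⟨e, he, N', hN'⟩ := H (fun x => -x ∈ X) (Dfn.comp hX' (DFun.neg DFun.id))
    refine ⟨d * e, by nlinarith, (max N N').toNat, fun x hx => ?_, fun x hx => ?_⟩
    · have := per_mul hd hN e.toNat x (by omega)
      rw [Int.toNat_of_nonneg (by omega), mul_comm] at this
      exact this
    · have := per_mul he hN' d.toNat (-x) (by omega)
      rw [Int.toNat_of_nonneg (by omega)] at this
      simp only [neg_neg] at this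
      rw [this]
      refine iff_of_eq (congrArg (· ∈ X) ?_)
      ring
  · intro h
    refine EP_of_Mnl fun P hP => ?_
    obtain ⟨d, hd, N, h1, -⟩ := h _ (univ_of_dfn hP)
    exact ⟨d, hd, N, h1⟩
end

section
/- Let L be a first-order language equipped with an L-structure on ℤ such that the order relation {(a,b) ∈ ℤ² : a < b}, the graph of addition {(a,b,c) ∈ ℤ³ : a + b = c}, and the singleton {1} are definable without parameters. Suppose the theory Th(ℤ,L) satisfies the exchange property. Then for every set X ⊆ ℤ that is L-definable with parameters, the set X ∩ ℕ is a finite union of points and of cosets of dℕ for some d ≥ 1; equivalently, there exist d ≥ 1 and N ∈ ℕ such that for every natural number x ≥ N, x ∈ X ↔ x + d ∈ X. -/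
open FirstOrder

namespace EPZ

/-- windows of length r at x and y agree -/
def Same (X : ℕ → Prop) (r x y : ℕ) : Prop := ∀ i < r, (X (x + i) ↔ X (y + i))

theorem Same.refl (X : ℕ → Prop) (r x : ℕ) : Same X r x x := fun _ _ => Iff.rfl
theorem Same.symm {X : ℕ → Prop} {r x y : ℕ} (h : Same X r x y) : Same X r y x :=
  fun i hi => (h i hi).symm
theorem Same.trans {X : ℕ → Prop} {r x y z : ℕ} (h : Same X r x y) (h' : Same X r y z) :
    Same X r x z := fun i hi => (h i hi).trans (h' i hi)

open Classical in
/-- least position with the same window -/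
noncomputable def rep (X : ℕ → Prop) (r x : ℕ) : ℕ :=
  Nat.find (p := fun y => Same X r x y) ⟨x, Same.refl X r x⟩

theorem rep_spec (X : ℕ → Prop) (r x : ℕ) : Same X r x (rep X r x) := by
  classical
  exact Nat.find_spec (p := fun y => Same X r x y) _

theorem rep_min (X : ℕ → Prop) (r x y : ℕ) (h : Same X r x y) : rep X r x ≤ y := by
  classical
  exact Nat.find_min' (p := fun y => Same X r x y) _ h

theorem rep_eq_iff {X : ℕ → Prop} {r x y : ℕ} : rep X r x = rep X r y ↔ Same X r x y := by
  constructor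
  · intro h
    have h1 := rep_spec X r x
    rw [h] at h1
    exact h1.trans (rep_spec X r y).symm
  · intro h
    exact le_antisymm (rep_min _ _ _ _ (h.trans (rep_spec X r y)))
      (rep_min _ _ _ _ (h.symm.trans (rep_spec X r x)))

theorem rep_rep_succ (X : ℕ → Prop) (r x : ℕ) : rep X r (rep X (r+1) x) = rep X r x := by
  rw [rep_eq_iff]
  exact fun i hi => ((rep_spec X (r+1) x) i (by omega)).symm

theorem range_rep_finite (X : ℕ → Prop) (r : ℕ) : (Set.range (rep X r)).Finite := by
  apply Set.Finite.of_injOn (f := fun a => fun i : Fin r => X (a + i)) (t := Set.univ)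
    (fun _ _ => Set.mem_univ _) _ (Set.toFinite _)
  rintro _ ⟨x, rfl⟩ _ ⟨y, rfl⟩ h
  rw [rep_eq_iff]
  refine (rep_spec X r x).trans (Same.trans ?_ (rep_spec X r y).symm)
  intro i hi
  have := congrFun h ⟨i, hi⟩
  simpa using this

/-- recurrent windows -/
def Rec (X : ℕ → Prop) (r : ℕ) : Set ℕ := {a | {x | rep X r x = a}.Infinite}

theorem Rec_finite (X : ℕ → Prop) (r : ℕ) : (Rec X r).Finite := by
  refine (range_rep_finite X r).subset ?_
  intro a ha
  obtain ⟨x, hx⟩ := ha.nonempty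
  exact ⟨x, hx⟩

theorem eventually_rec (X : ℕ → Prop) (r : ℕ) : ∃ N, ∀ x ≥ N, rep X r x ∈ Rec X r := by
  have : {x | rep X r x ∉ Rec X r}.Finite := by
    have h : ((⋃ a ∈ (Set.range (rep X r) \ Rec X r), {x | rep X r x = a})).Finite := by
      refine Set.Finite.biUnion ((range_rep_finite X r).subset Set.sdiff_subset) ?_
      rintro a ⟨_, ha⟩
      exact Set.not_infinite.1 ha
    refine h.subset ?_
    intro x hx
    simp only [Set.mem_iUnion]
    exact ⟨rep X r x, ⟨⟨x, rfl⟩, hx⟩, rfl⟩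
  obtain ⟨N, hN⟩ := this.bddAbove
  refine ⟨N + 1, fun x hx => ?_⟩
  by_contra h
  have := hN h
  omega

theorem rec_surj (X : ℕ → Prop) (r : ℕ) : Rec X r ⊆ rep X r '' Rec X (r+1) := by
  intro a ha
  obtain ⟨N, hN⟩ := eventually_rec X (r+1)
  obtain ⟨x, hx, hxN⟩ := Set.Infinite.exists_gt ha N
  exact ⟨rep X (r+1) x, hN x hxN.le, by rw [rep_rep_succ]; exact hx⟩

theorem step (X : ℕ → Prop)
    (hX : ¬ ∃ d : ℕ, 1 ≤ d ∧ ∃ N : ℕ, ∀ x ≥ N, (X x ↔ X (x + d))) (r : ℕ) :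
    (Rec X r).ncard < (Rec X (r+1)).ncard := by
  by_contra hlt
  push Not at hlt
  apply hX
  have hinj : Set.InjOn (rep X r) (Rec X (r+1)) := by
    apply Set.injOn_of_ncard_image_eq _ (Rec_finite X (r+1))
    apply le_antisymm (Set.ncard_image_le (Rec_finite X (r+1)))
    exact hlt.trans (Set.ncard_le_ncard (rec_surj X r) ((Rec_finite X (r+1)).image _))
  obtain ⟨N, hN⟩ := eventually_rec X (r+1)
  have key : ∀ x ≥ N, ∀ y ≥ N, Same X r x y → Same X (r+1) x y := by
    intro x hx y hy h
    rw [← rep_eq_iff]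
    apply hinj (hN x hx) (hN y hy)
    rw [rep_rep_succ, rep_rep_succ, rep_eq_iff]
    exact h
  obtain ⟨a, ha⟩ : (Rec X r).Nonempty := by
    obtain ⟨M, hM⟩ := eventually_rec X r
    exact ⟨_, hM M le_rfl⟩
  obtain ⟨x, hx, hxN⟩ := Set.Infinite.exists_gt ha N
  obtain ⟨y, hy, hyx⟩ := Set.Infinite.exists_gt ha x
  have hxy : ∀ k, Same X r (x + k) (y + k) := by
    intro k
    induction k with
    | zero => rw [← rep_eq_iff]; exact Eq.trans hx (Eq.symm hy)
    | succ k ih =>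
      have := key _ (by omega) _ (by omega) ih
      intro i hi
      have := this (i+1) (by omega)
      convert this using 2 <;> ring
  refine ⟨y - x, by omega, x, fun z hz => ?_⟩
  have := key _ (by omega) _ (by omega) (hxy (z - x)) 0 (by omega)
  convert this using 2 <;> omega

theorem rec_large (X : ℕ → Prop)
    (hX : ¬ ∃ d : ℕ, 1 ≤ d ∧ ∃ N : ℕ, ∀ x ≥ N, (X x ↔ X (x + d))) (r : ℕ) :
    r ≤ (Rec X r).ncard := by
  induction r with
  | zero => simp
  | succ r ih => have := step X hX r; omega

/-- sets to be put in the ultrafilter -/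
def K (X : ℕ → Prop) (p : (ℕ → ℤ) × (ℕ × ℕ → ℤ)) : Set (ℕ × ℕ) :=
  {i | (rep X i.1 i.2 : ℤ) ≠ p.1 i.1 ∧ (i.2 : ℤ) ≠ p.2 (i.1, rep X i.1 i.2)}

theorem exists_ultra (X : ℕ → Prop)
    (hX : ¬ ∃ d : ℕ, 1 ≤ d ∧ ∃ N : ℕ, ∀ x ≥ N, (X x ↔ X (x + d))) :
    ∃ U : Ultrafilter (ℕ × ℕ), ∀ p, K X p ∈ U := by
  have : (Filter.generate (Set.range (K X))).NeBot := by
    rw [Filter.generate_neBot_iff]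
    intro t ht htf
    have ht' : ∀ s ∈ t, ∃ p, K X p = s := ht
    choose! q hq using ht'
    obtain ⟨T, rfl⟩ := htf.exists_finset_coe
    classical
    set c := T.card + 1
    have h1 : ∃ a ∈ Rec X c, a ∉ T.image (fun s => ((q s).1 c).toNat) := by
      by_contra! hh
      have := Set.ncard_le_ncard (t := ((T.image (fun s => ((q s).1 c).toNat) : Finset ℕ) : Set ℕ))
        hh (Finset.finite_toSet _)
      rw [Set.ncard_coe_finset] at this
      have h2 := Finset.card_image_le (s := T) (f := fun s => ((q s).1 c).toNat)
      have h3 := rec_large X hX c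
      omega
    obtain ⟨a, ha, haT⟩ := h1
    obtain ⟨b, hb, hbT⟩ := Set.Infinite.exists_notMem_finset ha
      (T.image (fun s => ((q s).2 (c, a)).toNat))
    refine ⟨(c, b), ?_⟩
    intro s hs
    rw [← hq s hs]
    have hb' : rep X c b = a := hb
    simp only [K, Set.mem_ofPred_eq, hb']
    constructor
    · intro h
      exact haT (Finset.mem_image.2 ⟨s, hs, by simp [← h]⟩)
    · intro h
      exact hbT (Finset.mem_image.2 ⟨s, hs, by simp [← h]⟩)
  refine ⟨Ultrafilter.of (Filter.generate (Set.range (K X))), fun p => ?_⟩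
  exact Ultrafilter.of_le _ (Filter.mem_generate_of_mem ⟨p, rfl⟩)


section Def
variable {L : FirstOrder.Language} [L.Structure ℤ]

/-- definable predicate -/
def D (L : FirstOrder.Language) [L.Structure ℤ] {n : ℕ} (P : (Fin n → ℤ) → Prop) : Prop :=
  (Set.univ : Set ℤ).Definable L {v | P v}

theorem D.and {n : ℕ} {P Q : (Fin n → ℤ) → Prop} (h : D L P) (h' : D L Q) :
    D L (fun v => P v ∧ Q v) := Set.Definable.inter h h'

theorem D.not {n : ℕ} {P : (Fin n → ℤ) → Prop} (h : D L P) :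
    D L (fun v => ¬ P v) := Set.Definable.compl h

theorem D.iff {n : ℕ} {P Q : (Fin n → ℤ) → Prop} (h : D L P) (h' : D L Q) :
    D L (fun v => P v ↔ Q v) := by
  have : (fun v => P v ↔ Q v) = (fun v => ¬ (P v ∧ ¬ Q v) ∧ ¬ (Q v ∧ ¬ P v)) := by
    ext v; tauto
  rw [this]
  exact (h.and h'.not).not.and (h'.and h.not).not

theorem D.ex {n : ℕ} (Q : (Fin n → ℤ) → ℤ → Prop)
    (h : D L (fun w : Fin (n+1) → ℤ => Q (fun i => w i.castSucc) (w (Fin.last n)))) :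
    D L (fun v => ∃ x, Q v x) := by
  have := Set.Definable.image_comp h (Fin.castSucc : Fin n → Fin (n+1))
  unfold D
  convert this using 1
  ext v
  constructor
  · rintro ⟨x, hx⟩
    refine ⟨Fin.snoc v x, ?_, ?_⟩
    · simpa using hx
    · ext i; simp
  · rintro ⟨w, hw, rfl⟩
    exact ⟨_, hw⟩

theorem D.lt (hlt : (∅ : Set ℤ).Definable L {v : Fin 2 → ℤ | v 0 < v 1}) {n : ℕ} (i j : Fin n) :
    D L (fun v => v i < v j) := by
  have := (hlt.mono (Set.empty_subset Set.univ)).preimage_comp ![i, j]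
  exact this

theorem D.add (hadd : (∅ : Set ℤ).Definable L {v : Fin 3 → ℤ | v 0 + v 1 = v 2})
    {n : ℕ} (i j k : Fin n) : D L (fun v => v i + v j = v k) := by
  have := (hadd.mono (Set.empty_subset Set.univ)).preimage_comp ![i, j, k]
  exact this

theorem D.mem {X : Set ℤ} (hX : (Set.univ : Set ℤ).Definable₁ L X) {n : ℕ} (i : Fin n) :
    D L (fun v => v i ∈ X) := by
  have := Set.Definable.preimage_comp (β := Fin n) (fun _ => i) hX
  exact this

/-- integer version of agreement of windows -/
def SInt (X : Set ℤ) (b c a : ℤ) : Prop :=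
  ¬ ∃ i : ℤ, (0 ≤ i ∧ i < c) ∧ ¬ (b + i ∈ X ↔ a + i ∈ X)

/-- graph of least representative -/
def G (X : Set ℤ) (b c a : ℤ) : Prop :=
  (0 ≤ a ∧ SInt X b c a) ∧ ¬ ∃ a' : ℤ, (0 ≤ a' ∧ a' < a) ∧ SInt X b c a'

theorem D.nonneg
    (hlt : (∅ : Set ℤ).Definable L {v : Fin 2 → ℤ | v 0 < v 1})
    (hadd : (∅ : Set ℤ).Definable L {v : Fin 3 → ℤ | v 0 + v 1 = v 2})
    {n : ℕ} (i : Fin n) : D L (fun v => 0 ≤ v i) := by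
  have : (fun v : Fin n → ℤ => 0 ≤ v i) = (fun v => ∃ z : ℤ, z + z = z ∧ ¬ v i < z) := by
    ext v
    constructor
    · intro h; exact ⟨0, by omega, by omega⟩
    · rintro ⟨z, h1, h2⟩; omega
  rw [this]
  exact D.ex _ ((D.add hadd _ _ _).and (D.lt hlt _ _).not)

theorem D.memAdd
    (hadd : (∅ : Set ℤ).Definable L {v : Fin 3 → ℤ | v 0 + v 1 = v 2})
    (X : Set ℤ) (hX : (Set.univ : Set ℤ).Definable₁ L X)
    {n : ℕ} (i j : Fin n) : D L (fun v => v i + v j ∈ X) := by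
  have : (fun v : Fin n → ℤ => v i + v j ∈ X) = (fun v => ∃ z : ℤ, v i + v j = z ∧ z ∈ X) := by
    ext v; simp
  rw [this]
  exact D.ex _ ((D.add hadd _ _ _).and (D.mem hX _))

theorem D.sint
    (hlt : (∅ : Set ℤ).Definable L {v : Fin 2 → ℤ | v 0 < v 1})
    (hadd : (∅ : Set ℤ).Definable L {v : Fin 3 → ℤ | v 0 + v 1 = v 2})
    (X : Set ℤ) (hX : (Set.univ : Set ℤ).Definable₁ L X)
    {n : ℕ} (b c a : Fin n) : D L (fun v => SInt X (v b) (v c) (v a)) := by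
  unfold SInt
  refine D.not (D.ex _ ?_)
  exact ((D.nonneg hlt hadd _).and (D.lt hlt _ _)).and
    ((D.memAdd hadd X hX _ _).iff (D.memAdd hadd X hX _ _)).not

theorem D.graph
    (hlt : (∅ : Set ℤ).Definable L {v : Fin 2 → ℤ | v 0 < v 1})
    (hadd : (∅ : Set ℤ).Definable L {v : Fin 3 → ℤ | v 0 + v 1 = v 2})
    (X : Set ℤ) (hX : (Set.univ : Set ℤ).Definable₁ L X)
    : D L (fun v : Fin 3 → ℤ => G X (v 0) (v 1) (v 2)) := by
  unfold G
  refine D.and ((D.nonneg hlt hadd _).and (D.sint hlt hadd X hX _ _ _)) (D.not (D.ex _ ?_))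
  exact ((D.nonneg hlt hadd _).and (D.lt hlt _ _)).and (D.sint hlt hadd X hX _ _ _)

theorem sint_iff (X : Set ℤ) (b c a : ℕ) : SInt X b c a ↔ Same (fun x => (x : ℤ) ∈ X) c b a := by
  unfold SInt Same
  push Not
  constructor
  · intro h i hi
    have := h i ⟨by omega, by omega⟩
    push_cast
    tauto
  · rintro h i ⟨hi, hi'⟩
    lift i to ℕ using hi
    have := h i (by omega)
    push_cast at this
    tauto

theorem G_iff (X : Set ℤ) (b c : ℕ) (a : ℤ) : G X b c a ↔ a = rep (fun x => (x : ℤ) ∈ X) c b := by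
  constructor
  · rintro ⟨⟨h0, h1⟩, h2⟩
    lift a to ℕ using h0
    rw [sint_iff] at h1
    have h3 := rep_min _ _ _ _ h1
    by_contra hne
    exact h2 ⟨_, ⟨by omega, by omega⟩, (sint_iff X b c _).2 (rep_spec _ _ _)⟩
  · rintro rfl
    refine ⟨⟨by omega, (sint_iff X b c _).2 (rep_spec _ _ _)⟩, ?_⟩
    rintro ⟨a', ⟨h0, h1⟩, h2⟩
    lift a' to ℕ using h0
    rw [sint_iff] at h2
    have h3 := rep_min _ _ _ _ h2
    omega

end Def

section Ultra
open FirstOrder FirstOrder.Language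
variable {L : FirstOrder.Language} [L.Structure ℤ] {I : Type} (U : Ultrafilter I)

/-- the ultrapower -/
abbrev UP : Type := (U : Filter I).Product (fun _ => ℤ)

/-- class of a function -/
def mk (t : I → ℤ) : UP U := Quotient.mk _ t

theorem mk_eq {t t' : I → ℤ} : mk U t = mk U t' ↔ ∀ᶠ i in (U : Filter I), t i = t' i :=
  Quotient.eq''

theorem los {β : Type*} (φ : L.Formula β) (x : β → I → ℤ) :
    (φ.Realize fun i => mk U (x i)) ↔ ∀ᶠ a : I in U, φ.Realize fun i => x i a :=
  Ultraproduct.realize_formula_cast φ x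

theorem equiv : ℤ ≅[L] UP U := by
  rw [elementarilyEquivalent_iff]
  intro φ
  rw [Ultraproduct.sentence_realize]
  simp

theorem dcl_fun {J : Type} (s : I → J) (B : Set (UP U))
    (hB : ∀ x ∈ B, ∃ ρ : J → ℤ, x = mk U (ρ ∘ s)) (t : I → ℤ) (ht : mk U t ∈ dcl L (UP U) B) :
    ∃ h : J → ℤ, ∀ᶠ i in (U : Filter I), t i = h (s i) := by
  obtain ⟨φ, hφ⟩ := Set.definable_iff_exists_formula_sum.1 ht
  choose ρ hρ using fun x : B => hB x x.2
  have key : ∀ t' : I → ℤ, mk U t' = mk U t ↔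
      ∀ᶠ i in (U : Filter I), φ.Realize (Sum.elim (fun x => ρ x (s i)) (fun _ => t' i)) := by
    intro t'
    have h1 : (fun _ : Fin 1 => mk U t') ∈ {x : Fin 1 → UP U | x 0 ∈ ({mk U t} : Set (UP U))} ↔
      mk U t' = mk U t := Iff.rfl
    rw [← h1, hφ]
    have h2 := los (L := L) U φ (Sum.elim (fun x i => ρ x (s i)) (fun _ => t'))
    have e1 : (fun i => mk U ((Sum.elim (fun (x : B) i => ρ x (s i)) (fun _ : Fin 1 => t')) i))
        = Sum.elim ((↑) : B → UP U) (fun _ => mk U t') := by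
      ext i
      rcases i with i | i
      · exact (hρ i).symm
      · rfl
    have e2 : ∀ a, (fun i => (Sum.elim (fun (x : B) i => ρ x (s i)) (fun _ : Fin 1 => t')) i a)
        = Sum.elim (fun x => ρ x (s a)) (fun _ => t' a) := by
      intro a
      ext i
      rcases i with i | i <;> rfl
    rw [e1] at h2
    simp only [e2] at h2
    exact h2
  classical
  refine ⟨fun j => Classical.epsilon fun y => φ.Realize (Sum.elim (fun x => ρ x j) (fun _ => y)), ?_⟩
  have h1 := (key t).1 rfl
  rw [← mk_eq, eq_comm, key]
  filter_upwards [h1] with i hi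
  exact Classical.epsilon_spec (p := fun y => φ.Realize (Sum.elim (fun x => ρ x (s i)) (fun _ => y)))
    ⟨_, hi⟩

theorem mem_dcl (P : (Fin 3 → ℤ) → Prop) (hP : D L P) (B : Set (UP U))
    (hB : ∀ k : ℤ, mk U (fun _ => k) ∈ B) (b c a : I → ℤ) (hb : mk U b ∈ B) (hc : mk U c ∈ B)
    (h : ∀ i x, P ![b i, c i, x] ↔ x = a i) : mk U a ∈ dcl L (UP U) B := by
  obtain ⟨φ, hφ⟩ := Set.definable_iff_exists_formula_sum.1 hP
  refine Set.definable_iff_exists_formula_sum.2 ⟨φ.relabel (Sum.elim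
    (fun k : (Set.univ : Set ℤ) => Sum.inl (⟨_, hB k⟩ : B))
    ![Sum.inl ⟨_, hb⟩, Sum.inl ⟨_, hc⟩, Sum.inr 0]), ?_⟩
  ext v
  obtain ⟨t, ht⟩ : ∃ t, mk U t = v 0 := Quotient.exists_rep (v 0)
  have h2 := los (L := L) U φ (Sum.elim (fun k _ => (k : ℤ)) ![b, c, t])
  have e1 : (fun i => mk U ((Sum.elim (fun (k : (Set.univ : Set ℤ)) _ => (k : ℤ)) ![b, c, t]) i))
      = Sum.elim ((↑) : B → UP U) v ∘ (Sum.elim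
    (fun k : (Set.univ : Set ℤ) => Sum.inl (⟨_, hB k⟩ : B))
    ![Sum.inl ⟨_, hb⟩, Sum.inl ⟨_, hc⟩, Sum.inr 0]) := by
    ext i
    rcases i with i | i
    · rfl
    · fin_cases i
      · rfl
      · rfl
      · exact ht
  have e2 : ∀ a, (fun i => (Sum.elim (fun (k : (Set.univ : Set ℤ)) _ => (k : ℤ)) ![b, c, t]) i a)
      = Sum.elim (↑) ![b a, c a, t a] := by
    intro a
    ext i
    rcases i with i | i
    · rfl
    · fin_cases i <;> rfl
  rw [e1] at h2
  simp only [e2] at h2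
  have h3 : ∀ w : Fin 3 → ℤ, φ.Realize (Sum.elim (↑) w) ↔ P w := by
    intro w
    have : w ∈ {v | P v} ↔ P w := Iff.rfl
    rw [← this, hφ]
    rfl
  simp only [h3, h] at h2
  rw [← mk_eq, ht] at h2
  rw [Set.mem_ofPred_eq, Set.mem_ofPred_eq, Formula.realize_relabel, h2]
  rfl

end Ultra

end EPZ

theorem EP_implies_eventually_periodic_on_nat (L : FirstOrder.Language) [L.Structure ℤ]
    (hlt : (∅ : Set ℤ).Definable L {v : Fin 2 → ℤ | v 0 < v 1})
    (hadd : (∅ : Set ℤ).Definable L {v : Fin 3 → ℤ | v 0 + v 1 = v 2})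
    (hone : (∅ : Set ℤ).Definable₁ L ({1} : Set ℤ))
    (hEP : HasEP L)
    (X : Set ℤ) (hX : (Set.univ : Set ℤ).Definable₁ L X) :
    ∃ d : ℤ, 1 ≤ d ∧ ∃ N : ℕ,
      ∀ x : ℕ, N ≤ x → ((x : ℤ) ∈ X ↔ (x : ℤ) + d ∈ X) := by
  classical
  by_contra hcon
  have hper : ¬ ∃ d : ℕ, 1 ≤ d ∧ ∃ N : ℕ, ∀ x ≥ N,
      ((fun x : ℕ => (x : ℤ) ∈ X) x ↔ (fun x : ℕ => (x : ℤ) ∈ X) (x + d)) := by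
    rintro ⟨d, hd, N, h⟩
    refine hcon ⟨d, by omega, N, fun x hx => ?_⟩
    have := h x hx
    push_cast at this
    exact this
  obtain ⟨U, hU⟩ := EPZ.exists_ultra _ hper
  set Y : ℕ → Prop := fun x : ℕ => (x : ℤ) ∈ X with hY
  let A : Set (EPZ.UP U) := {x | ∃ ρ : ℕ → ℤ, x = EPZ.mk U (ρ ∘ Prod.fst)}
  let α : ℕ × ℕ → ℤ := fun i => (EPZ.rep Y i.1 i.2 : ℤ)
  let β : ℕ × ℕ → ℤ := fun i => (i.2 : ℤ)
  have h1 : EPZ.mk U α ∈ dcl L (EPZ.UP U) (A ∪ {EPZ.mk U β}) := by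
    refine EPZ.mem_dcl U _ (EPZ.D.graph hlt hadd X hX) _ ?_ β (fun i => (i.1 : ℤ)) α ?_ ?_ ?_
    · exact fun k => Or.inl ⟨fun _ => k, rfl⟩
    · exact Or.inr rfl
    · exact Or.inl ⟨fun n => n, rfl⟩
    · exact fun i x => EPZ.G_iff X i.2 i.1 x
  have h2 : EPZ.mk U α ∉ dcl L (EPZ.UP U) A := by
    intro h
    obtain ⟨f, hf⟩ := EPZ.dcl_fun U Prod.fst A (fun x hx => hx) α h
    obtain ⟨i, hi, hi'⟩ := (hf.and (hU (f, fun _ => 0))).exists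
    exact hi'.1 hi
  have h3 := hEP (EPZ.UP U) (EPZ.equiv U) A _ _ h1 h2
  obtain ⟨f, hf⟩ := EPZ.dcl_fun U (fun i : ℕ × ℕ => (i.1, EPZ.rep Y i.1 i.2)) _ (by
    rintro x (⟨ρ, hρ⟩ | hx)
    · exact ⟨fun p => ρ p.1, hρ⟩
    · exact ⟨fun p => p.2, hx⟩) β h3
  obtain ⟨i, hi, hi'⟩ := (hf.and (hU (fun _ => 0, f))).exists
  exact hi'.2 hi
end
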